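/- arXiv:1811.01351 — 3 statements merged into one kernel-verified Lean document; each statement's English description precedes it below -/
import Mathlib

section
/- For all natural numbers n and k, every indexed set Q of polynomials of degree at most k on n pairs of twin variables, and all positive integers s and w: if there is a PS refutation from Q of product-width at most w and monomial size at most s, then there is a PS refutation from Q of product-width at most w and degree at most 4·√(2(n+1)·log s) + k·w + 4, where log denotes the natural logarithm. -/
open MvPolynomial

noncomputable section

/-- The polynomial ring in `n` pairs of twin variables: `Sum.inl i` is the basic
variable `xᵢ` and `Sum.inr i` is its twin `x̄ᵢ`. -/
abbrev MvPoly (n : ℕ) : Type := MvPolynomial (Fin n ⊕ Fin n) ℝ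

/-- The Boolean axioms `xᵢ² − xᵢ`, `x̄ᵢ² − x̄ᵢ` and `xᵢ + x̄ᵢ − 1`. -/
def boolAxiom (n : ℕ) (a : Fin 3 × Fin n) : MvPoly n :=
  if a.1 = 0 then X (Sum.inl a.2) ^ 2 - X (Sum.inl a.2)
  else if a.1 = 1 then X (Sum.inr a.2) ^ 2 - X (Sum.inr a.2)
  else X (Sum.inl a.2) + X (Sum.inr a.2) - 1

/-- The sum of squares of a list of polynomials. -/
def sosOf {n : ℕ} (l : List (MvPoly n)) : MvPoly n := (l.map (· ^ 2)).sum

/-- A Positivstellensatz proof of `goal ≥ 0` from the inequality constraints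
`q j ≥ 0` (`j : Fin ℓ`) and the equality constraints `p j = 0` (`j : Fin m`),
on `n` pairs of twin variables. -/
structure PSProof (n ℓ m : ℕ) (q : Fin ℓ → MvPoly n) (p : Fin m → MvPoly n)
    (goal : MvPoly n) : Type where
  Js : Finset (Finset (Fin ℓ))
  empty_not_mem : ∅ ∉ Js
  r0 : List (MvPoly n)
  r : Finset (Fin ℓ) → List (MvPoly n)
  t : Fin m → MvPoly n
  u : Fin 3 × Fin n → MvPoly n
  identity : goal = sosOf r0 + ∑ J ∈ Js, sosOf (r J) * ∏ j ∈ J, q j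
      + ∑ j, t j * p j + ∑ a, u a * boolAxiom n a

namespace PSProof

variable {n ℓ m : ℕ} {q : Fin ℓ → MvPoly n} {p : Fin m → MvPoly n} {goal : MvPoly n}

/-- The proof has product-width at most `w`. -/
def widthLE (π : PSProof n ℓ m q p goal) (w : ℕ) : Prop := ∀ J ∈ π.Js, J.card ≤ w

/-- The proof has degree at most `d` (the zero polynomial having degree `−∞`). -/
def degreeLE (π : PSProof n ℓ m q p goal) (d : ℕ) : Prop :=
  goal.totalDegree ≤ d ∧ (sosOf π.r0).totalDegree ≤ d ∧
  (∀ J ∈ π.Js, sosOf (π.r J) ≠ 0 →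
    (sosOf (π.r J)).totalDegree + ∑ j ∈ J, (q j).totalDegree ≤ d) ∧
  (∀ j, π.t j ≠ 0 → (π.t j).totalDegree + (p j).totalDegree ≤ d)

/-- The monomial size of the proof: the total number of monomials of the `r` and `t`
polynomials. -/
def size (π : PSProof n ℓ m q p goal) : ℕ :=
  (π.r0.map fun r => r.support.card).sum
  + ∑ J ∈ π.Js, ((π.r J).map fun r => r.support.card).sum
  + ∑ j, (π.t j).support.card

end PSProof

/-! ### Functions on the cube -/

namespace PSAux

abbrev Lit (n : ℕ) : Type := Fin n ⊕ Fin n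
abbrev CubeFun (n : ℕ) : Type := (Fin n → Bool) → ℝ

/-- Value of a literal on a point of the cube. -/
def lit {n : ℕ} (v : Lit n) : CubeFun n := fun σ =>
  Sum.elim (fun i => if σ i then (1 : ℝ) else 0) (fun i => if σ i then (0 : ℝ) else 1) v

/-- A (multilinear) monomial as a function on the cube. -/
def mon {n : ℕ} (T : Finset (Lit n)) : CubeFun n := ∏ v ∈ T, lit v

/-- Functions of degree at most `d`. -/
def Pd (n d : ℕ) : Submodule ℝ (CubeFun n) :=
  Submodule.span ℝ {f | ∃ T : Finset (Lit n), T.card ≤ d ∧ f = mon T}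

/-- Evaluation of polynomials on the cube. -/
def ev {n : ℕ} : MvPoly n →ₐ[ℝ] CubeFun n := aeval (fun v => lit v)

lemma lit_sq {n : ℕ} (v : Lit n) : lit v * lit v = lit v := by
  funext σ
  rcases v with i | i <;> by_cases h : σ i <;> simp [lit, h]

lemma lit_swap {n : ℕ} (v : Lit n) : lit v.swap = 1 - lit v := by
  funext σ
  rcases v with i | i <;> by_cases h : σ i <;> simp [lit, h]

lemma lit_zero_or_one {n : ℕ} (v : Lit n) (σ : Fin n → Bool) : lit v σ = 0 ∨ lit v σ = 1 := by
  rcases v with i | i <;> by_cases h : σ i <;> simp [lit, h]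

lemma mon_empty {n : ℕ} : mon (∅ : Finset (Lit n)) = 1 := by simp [mon]

lemma mon_insert {n : ℕ} (v : Lit n) (T : Finset (Lit n)) :
    mon (insert v T) = lit v * mon T := by
  by_cases h : v ∈ T
  · rw [Finset.insert_eq_of_mem h, mon, ← Finset.mul_prod_erase T _ h, ← mul_assoc, lit_sq]
  · simp [mon, Finset.prod_insert h]

lemma mon_singleton {n : ℕ} (v : Lit n) : mon {v} = lit v := by simp [mon]

lemma mon_union {n : ℕ} (S T : Finset (Lit n)) : mon (S ∪ T) = mon S * mon T := by
  induction S using Finset.induction_on with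
  | empty => simp [mon_empty]
  | insert a S _ ih => rw [Finset.insert_union, mon_insert, mon_insert, ih, mul_assoc]

lemma mon_sq {n : ℕ} (T : Finset (Lit n)) : mon T * mon T = mon T := by
  rw [← mon_union, Finset.union_self]

lemma mon_mem {n d : ℕ} {T : Finset (Lit n)} (h : T.card ≤ d) : mon T ∈ Pd n d :=
  Submodule.subset_span ⟨T, h, rfl⟩

lemma one_mem_Pd {n d : ℕ} : (1 : CubeFun n) ∈ Pd n d := by
  rw [← mon_empty]; exact mon_mem (by simp)

lemma lit_mem_Pd {n d : ℕ} (hd : 1 ≤ d) (v : Lit n) : lit v ∈ Pd n d := by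
  rw [← mon_singleton]; exact mon_mem (by simpa using hd)

lemma Pd_mono {n a b : ℕ} (h : a ≤ b) : Pd n a ≤ Pd n b := by
  apply Submodule.span_mono
  rintro f ⟨T, hT, rfl⟩
  exact ⟨T, hT.trans h, rfl⟩

lemma Pd_mul {n a b : ℕ} {f g : CubeFun n} (hf : f ∈ Pd n a) (hg : g ∈ Pd n b) :
    f * g ∈ Pd n (a + b) := by
  have h := Submodule.mul_mem_mul hf hg
  rw [Pd, Pd, Submodule.span_mul_span] at h
  refine Submodule.span_mono ?_ h
  rintro _ ⟨_, ⟨S, hS, rfl⟩, _, ⟨T, hT, rfl⟩, rfl⟩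
  exact ⟨S ∪ T, (Finset.card_union_le _ _).trans (by omega), (mon_union S T).symm⟩

lemma ev_X {n : ℕ} (v : Lit n) : ev (X v : MvPoly n) = lit v := by simp [ev]

lemma ev_monomial {n : ℕ} (m : Lit n →₀ ℕ) (a : ℝ) :
    ev (monomial m a : MvPoly n) = a • mon m.support := by
  have hp : ∀ (v : Lit n) (e : ℕ), e ≠ 0 → lit v ^ e = lit v := by
    intro v e he
    obtain ⟨e, rfl⟩ := Nat.exists_eq_succ_of_ne_zero he
    induction e with
    | zero => simp
    | succ e ih => rw [pow_succ, ih (by simp), lit_sq]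
  rw [ev, aeval_monomial, Algebra.smul_def, mon, Finsupp.prod]
  congr 1
  exact Finset.prod_congr rfl fun v hv => hp v _ (Finsupp.mem_support_iff.1 hv)

lemma ev_eq_sum {n : ℕ} (f : MvPoly n) :
    ev f = ∑ m ∈ f.support, coeff m f • mon m.support := by
  conv_lhs => rw [f.as_sum]
  rw [map_sum]
  exact Finset.sum_congr rfl fun m _ => ev_monomial _ _

lemma ev_mem {n d : ℕ} {f : MvPoly n} (hf : f.totalDegree ≤ d) : ev f ∈ Pd n d := by
  rw [ev_eq_sum]
  refine Submodule.sum_mem _ fun m hm => Submodule.smul_mem _ _ (mon_mem ?_)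
  refine le_trans ?_ ((le_totalDegree hm).trans hf)
  rw [Finsupp.sum, Finset.card_eq_sum_ones]
  exact Finset.sum_le_sum fun v hv => Nat.one_le_iff_ne_zero.2 (Finsupp.mem_support_iff.1 hv)

lemma exists_poly {n d : ℕ} {f : CubeFun n} (hf : f ∈ Pd n d) :
    ∃ g : MvPoly n, g.totalDegree ≤ d ∧ ev g = f := by
  induction hf using Submodule.span_induction with
  | mem f hf =>
    obtain ⟨T, hT, rfl⟩ := hf
    refine ⟨∏ v ∈ T, X v, ?_, ?_⟩
    · refine (totalDegree_finsetProd _ _).trans ?_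
      simpa using hT
    · simp [ev, mon]
  | zero => exact ⟨0, by simp, by simp⟩
  | add f g _ _ ihf ihg =>
    obtain ⟨a, ha, rfl⟩ := ihf
    obtain ⟨b, hb, rfl⟩ := ihg
    exact ⟨a + b, (totalDegree_add _ _).trans (max_le ha hb), by simp⟩
  | smul c f _ ih =>
    obtain ⟨a, ha, rfl⟩ := ih
    exact ⟨c • a, (totalDegree_smul_le _ _).trans ha, by simp⟩

lemma ev_boolAxiom {n : ℕ} (a : Fin 3 × Fin n) : ev (boolAxiom n a) = 0 := by
  unfold boolAxiom
  split_ifs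
  · rw [map_sub, map_pow, ev_X, sq, lit_sq, sub_self]
  · rw [map_sub, map_pow, ev_X, sq, lit_sq, sub_self]
  · rw [map_sub, map_add, ev_X, ev_X, map_one, show (Sum.inr a.2 : Lit n) = (Sum.inl a.2 : Lit n).swap from rfl,
      lit_swap]
    ring

/-- Nullstellensatz on the cube. -/
lemma nullstellensatz {n : ℕ} (f : MvPoly n) (hf : ev f = 0) :
    ∃ u : Fin 3 × Fin n → MvPoly n, f = ∑ a, u a * boolAxiom n a := by
  set I : Ideal (MvPoly n) := Ideal.span (Set.range (boolAxiom n)) with hI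
  suffices h : f ∈ I by
    obtain ⟨u, hu⟩ := Ideal.mem_span_range_iff_exists_fun.1 h
    exact ⟨u, hu.symm⟩
  let φ := Ideal.Quotient.mk I
  have hax : ∀ a, φ (boolAxiom n a) = 0 := fun a =>
    Ideal.Quotient.eq_zero_iff_mem.2 (Ideal.subset_span ⟨a, rfl⟩)
  have h0 : ∀ i, φ (X (Sum.inl i)) * φ (X (Sum.inl i)) = φ (X (Sum.inl i)) := by
    intro i
    have := hax (0, i)
    simp only [boolAxiom, if_true, map_sub, map_pow] at this
    rw [← sq]; exact sub_eq_zero.1 this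
  have h1 : ∀ i, φ (X (Sum.inr i)) = 1 - φ (X (Sum.inl i)) := by
    intro i
    have := hax (2, i)
    simp [boolAxiom] at this
    linear_combination this
  let g : Fin n → Bool → (MvPoly n ⧸ I) := fun i b =>
    if b then φ (X (Sum.inl i)) else φ (X (Sum.inr i))
  let δ : (Fin n → Bool) → (MvPoly n ⧸ I) := fun σ => ∏ i, g i (σ i)
  have hsum : ∑ σ, δ σ = 1 := by
    have : ∏ i, ∑ b, g i b = ∑ σ, δ σ := by
      rw [Finset.prod_univ_sum, Fintype.piFinset_univ]
    rw [← this]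
    apply Finset.prod_eq_one
    intro i _
    simp [g, h1]
  have hX : ∀ v σ, φ (X v) * δ σ = φ (C (lit v σ)) * δ σ := by
    intro v σ
    have key : ∀ i (a b : MvPoly n ⧸ I), a * g i (σ i) = b * g i (σ i) → a * δ σ = b * δ σ := by
      intro i a b h
      simp only [δ]
      rw [← Finset.mul_prod_erase Finset.univ _ (Finset.mem_univ i), ← mul_assoc, h, mul_assoc]
    rcases v with i | i
    · apply key i
      by_cases h : σ i
      · simp [g, lit, h, h0]
      · simp [g, lit, h, h1, mul_sub, h0]
    · apply key i
      by_cases h : σ i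
      · simp [g, lit, h, h1, sub_mul, h0]
      · simp [g, lit, h, h1, mul_sub, sub_mul, h0]
  have hall : ∀ p σ, φ p * δ σ = φ (C (ev p σ)) * δ σ := by
    intro p σ
    induction p using MvPolynomial.induction_on with
    | C a => simp [ev]
    | add p q hp hq => simp only [map_add, Pi.add_apply, add_mul, hp, hq]
    | mul_X p v hp =>
      rw [map_mul, mul_assoc, hX, mul_left_comm, hp, map_mul, Pi.mul_apply, ev_X, map_mul, map_mul]
      ring
  have : φ f = 0 := by
    rw [← mul_one (φ f), ← hsum, Finset.mul_sum]
    apply Finset.sum_eq_zero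
    intro σ _
    rw [hall, hf]
    simp
  exact Ideal.Quotient.eq_zero_iff_mem.1 this

/-! ### The cones -/

section cone

variable {n ℓ m : ℕ} (q : Fin ℓ → MvPoly n) (p : Fin m → MvPoly n) (w c : ℕ)

/-- Generators of the cone of consequences. -/
def gens (D : ℕ) : Set (CubeFun n) :=
  {f | (∃ r ∈ Pd n (D + c), f = r * r) ∨
    (∃ J : Finset (Fin ℓ), J.Nonempty ∧ J.card ≤ w ∧ ∃ r ∈ Pd n D,
      f = r * r * ∏ j ∈ J, ev (q j)) ∨
    (∃ j : Fin m, ∃ t ∈ Pd n (2 * D), f = t * ev (p j))}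

def K (D : ℕ) : AddSubmonoid (CubeFun n) := AddSubmonoid.closure (gens q p w c D)

/-- There is a refutation valid on the points of `A`. -/
def Ref (A : Set (Fin n → Bool)) (D : ℕ) : Prop :=
  ∃ R ∈ K q p w c D, ∀ σ ∈ A, R σ = -1

variable {q p w c}

lemma K_smul {D : ℕ} {f : CubeFun n} (hf : f ∈ K q p w c D) {a : ℝ} (ha : 0 ≤ a) :
    a • f ∈ K q p w c D := by
  have hs : a = √a * √a := (Real.mul_self_sqrt ha).symm
  induction hf using AddSubmonoid.closure_induction with
  | mem f hf =>
    apply AddSubmonoid.subset_closure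
    rcases hf with ⟨r, hr, rfl⟩ | ⟨J, hJ, hJw, r, hr, rfl⟩ | ⟨j, t, ht, rfl⟩
    · refine Or.inl ⟨√a • r, Submodule.smul_mem _ _ hr, ?_⟩
      rw [smul_mul_smul_comm, ← hs]
    · refine Or.inr (Or.inl ⟨J, hJ, hJw, √a • r, Submodule.smul_mem _ _ hr, ?_⟩)
      rw [smul_mul_smul_comm, ← hs, smul_mul_assoc]
    · exact Or.inr (Or.inr ⟨j, a • t, Submodule.smul_mem _ _ ht, by rw [smul_mul_assoc]⟩)
  | zero => simp
  | add f g _ _ hf hg => rw [smul_add]; exact add_mem hf hg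

lemma sq_mem_K {D : ℕ} {r : CubeFun n} (hr : r ∈ Pd n (D + c)) : r * r ∈ K q p w c D :=
  AddSubmonoid.subset_closure (Or.inl ⟨r, hr, rfl⟩)

lemma lit_mul_K {D : ℕ} (v : Lit n) {f : CubeFun n} (hf : f ∈ K q p w c D) :
    lit v * f ∈ K q p w c (D + 1) := by
  have h1 := lit_mem_Pd le_rfl v
  induction hf using AddSubmonoid.closure_induction with
  | mem f hf =>
    apply AddSubmonoid.subset_closure
    rcases hf with ⟨r, hr, rfl⟩ | ⟨J, hJ, hJw, r, hr, rfl⟩ | ⟨j, t, ht, rfl⟩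
    · refine Or.inl ⟨lit v * r, Pd_mono (by omega) (Pd_mul h1 hr), ?_⟩
      rw [mul_mul_mul_comm, lit_sq]
    · refine Or.inr (Or.inl ⟨J, hJ, hJw, lit v * r, Pd_mono (by omega) (Pd_mul h1 hr), ?_⟩)
      rw [mul_mul_mul_comm, lit_sq, ← mul_assoc (lit v)]
    · exact Or.inr (Or.inr ⟨j, lit v * t, Pd_mono (by omega) (Pd_mul h1 ht), by rw [mul_assoc]⟩)
  | zero => simp
  | add f g _ _ hf hg => rw [mul_add]; exact add_mem hf hg

lemma prod_mem {k : ℕ} (hq : ∀ j, (q j).totalDegree ≤ k) (J : Finset (Fin ℓ)) :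
    ∏ j ∈ J, ev (q j) ∈ Pd n (k * J.card) := by
  induction J using Finset.induction_on with
  | empty => simpa using one_mem_Pd
  | insert a J ha ih =>
    rw [Finset.prod_insert ha, Finset.card_insert_of_notMem ha]
    exact Pd_mono (by rw [mul_add]; omega) (Pd_mul (ev_mem (hq a)) ih)

lemma K_le {k D : ℕ} (hq : ∀ j, (q j).totalDegree ≤ k) (hp : ∀ j, (p j).totalDegree ≤ k)
    (hw : 0 < w) (hc : k * w ≤ 2 * c) {f : CubeFun n} (hf : f ∈ K q p w c D) :
    f ∈ Pd n (2 * (D + c)) := by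
  induction hf using AddSubmonoid.closure_induction with
  | mem f hf =>
    rcases hf with ⟨r, hr, rfl⟩ | ⟨J, hJ, hJw, r, hr, rfl⟩ | ⟨j, t, ht, rfl⟩
    · exact Pd_mono (by omega) (Pd_mul hr hr)
    · have := Nat.mul_le_mul_left k hJw
      exact Pd_mono (by omega) (Pd_mul (Pd_mul hr hr) (prod_mem hq J))
    · have := Nat.mul_le_mul_left k hw
      exact Pd_mono (by rw [Nat.succ_eq_add_one, zero_add, mul_one] at this; omega) (Pd_mul ht (ev_mem (hp j)))
  | zero => exact zero_mem _
  | add f g _ _ hf hg => exact add_mem hf hg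

lemma exists_split {n D : ℕ} (T : Finset (Lit n)) (hT : T.card ≤ 2 * D) (S : Finset (Lit n))
    (hS : S ⊆ T) (hSD : S.card ≤ D) :
    ∃ T1 T2 : Finset (Lit n), S ⊆ T1 ∧ T1.card ≤ D ∧ T2.card ≤ D ∧ T1 ∪ T2 = T := by
  by_cases h : T.card ≤ D
  · exact ⟨T, ∅, hS, h, by simp, by simp⟩
  · obtain ⟨U, hU1, hU2, hU3⟩ := Finset.exists_subsuperset_card_eq hS hSD (by omega : D ≤ T.card)
    refine ⟨U, T \ U, hU1, hU3.le, ?_, Finset.union_sdiff_of_subset hU2⟩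
    rw [Finset.card_sdiff_of_subset hU2]; omega

lemma order_unit {D : ℕ} {f : CubeFun n} (hf : f ∈ Pd n (2 * (D + c))) :
    (∃ a : ℝ, a • (1 : CubeFun n) + f ∈ K q p w c D) ∧
    (∃ a : ℝ, a • (1 : CubeFun n) - f ∈ K q p w c D) := by
  induction hf using Submodule.span_induction with
  | mem f hf =>
    obtain ⟨T, hT, rfl⟩ := hf
    obtain ⟨T1, T2, -, h1, h2, rfl⟩ := exists_split T hT ∅ (by simp) (by simp)
    have e1 := mon_sq T1
    have e2 := mon_sq T2
    have m1 := mon_mem h1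
    have m2 := mon_mem h2
    have s1 : (1 - mon T1) * (1 - mon T1) ∈ K q p w c D := sq_mem_K (sub_mem one_mem_Pd m1)
    have s2 : (1 - mon T2) * (1 - mon T2) ∈ K q p w c D := sq_mem_K (sub_mem one_mem_Pd m2)
    have s3 : (mon T1 + mon T2) * (mon T1 + mon T2) ∈ K q p w c D := sq_mem_K (add_mem m1 m2)
    have s4 : (mon T1 - mon T2) * (mon T1 - mon T2) ∈ K q p w c D := sq_mem_K (sub_mem m1 m2)
    have hh : (0 : ℝ) ≤ 1 / 2 := by norm_num
    refine ⟨⟨1, ?_⟩, ⟨1, ?_⟩⟩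
    · convert K_smul (add_mem (add_mem s3 s1) s2) hh using 1
      rw [mon_union]
      funext σ
      have e1 := congrFun e1 σ
      have e2 := congrFun e2 σ
      simp at e1 e2 ⊢
      linear_combination -e1 - e2
    · convert K_smul (add_mem (add_mem s4 s1) s2) hh using 1
      rw [mon_union]
      funext σ
      have e1 := congrFun e1 σ
      have e2 := congrFun e2 σ
      simp at e1 e2 ⊢
      linear_combination -e1 - e2
  | zero => exact ⟨⟨0, by simp⟩, ⟨0, by simp⟩⟩
  | add f g _ _ hf hg =>
    obtain ⟨⟨a, ha⟩, ⟨b, hb⟩⟩ := hf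
    obtain ⟨⟨a', ha'⟩, ⟨b', hb'⟩⟩ := hg
    refine ⟨⟨a + a', ?_⟩, ⟨b + b', ?_⟩⟩
    · convert add_mem ha ha' using 1
      rw [add_smul]; abel
    · convert add_mem hb hb' using 1
      rw [add_smul]; abel
  | smul r f _ hf =>
    obtain ⟨⟨a, ha⟩, ⟨b, hb⟩⟩ := hf
    rcases le_total 0 r with hr | hr
    · refine ⟨⟨r * a, ?_⟩, ⟨r * b, ?_⟩⟩
      · convert K_smul ha hr using 1
        rw [smul_add, mul_smul]
      · convert K_smul hb hr using 1
        rw [smul_sub, mul_smul]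
    · have hr' : 0 ≤ -r := by linarith
      refine ⟨⟨-r * b, ?_⟩, ⟨-r * a, ?_⟩⟩
      · convert K_smul hb hr' using 1
        module
      · convert K_smul ha hr' using 1
        module

/-- Existence of pseudo-expectations. -/
lemma exists_functional {k D : ℕ} (hq : ∀ j, (q j).totalDegree ≤ k)
    (hp : ∀ j, (p j).totalDegree ≤ k) (hw : 0 < w) (hc : k * w ≤ 2 * c)
    (A : Set (Fin n → Bool)) (hA : ¬ Ref q p w c A D) :
    ∃ L : CubeFun n →ₗ[ℝ] ℝ, L 1 = 1 ∧ (∀ f ∈ K q p w c D, 0 ≤ L f) ∧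
      (∀ f ∈ Pd n (2 * (D + c)), (∀ σ ∈ A, f σ = 0) → L f = 0) := by
  let E := Pd n (2 * (D + c))
  let C : PointedCone ℝ E :=
    { carrier := {f | ∃ R ∈ K q p w c D, ∀ σ ∈ A, (f : CubeFun n) σ = R σ}
      smul_mem' := by
        rintro ⟨a, ha⟩ f ⟨R, hR, h⟩
        refine ⟨a • R, K_smul hR ha, fun σ hσ => ?_⟩
        simp [h σ hσ]
      zero_mem' := ⟨0, zero_mem _, fun σ _ => by simp⟩
      add_mem' := by
        rintro f g ⟨R, hR, h⟩ ⟨R', hR', h'⟩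
        refine ⟨R + R', add_mem hR hR', fun σ hσ => ?_⟩
        simp [h σ hσ, h' σ hσ] }
  let e : E := ⟨1, one_mem_Pd⟩
  have he : e ≠ 0 := by
    intro h
    have : (1 : CubeFun n) = 0 := congrArg Subtype.val h
    exact one_ne_zero this
  obtain ⟨g, hg1, hg2⟩ := riesz_extension C (LinearPMap.mkSpanSingleton (K := ℝ) e (1 : ℝ) he) (by
      rintro ⟨x, hx⟩ hxC
      obtain ⟨a, rfl⟩ := Submodule.mem_span_singleton.1 hx
      rw [LinearPMap.mkSpanSingleton'_apply]
      by_contra hneg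
      have hneg : a < 0 := by simpa using hneg
      obtain ⟨R, hR, h⟩ := hxC
      apply hA
      refine ⟨(-a)⁻¹ • R, K_smul hR (by rw [inv_nonneg]; linarith), fun σ hσ => ?_⟩
      have := h σ hσ
      simp [e] at this
      rw [Pi.smul_apply, ← this, smul_eq_mul]
      have : a ≠ 0 := hneg.ne
      field_simp) (by
      rintro ⟨y, hy⟩
      obtain ⟨⟨a, ha⟩, -⟩ := order_unit (q := q) (p := p) (w := w) (c := c) hy
      refine ⟨⟨a • e, Submodule.mem_span_singleton.2 ⟨a, rfl⟩⟩, ?_⟩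
      exact ⟨_, ha, fun σ _ => by simp [e]⟩)
  obtain ⟨L, hL⟩ := LinearMap.exists_extend g
  have hLe : ∀ f (hf : f ∈ E), L f = g ⟨f, hf⟩ := fun f hf => by rw [← hL]; rfl
  refine ⟨L, ?_, ?_, ?_⟩
  · rw [hLe 1 one_mem_Pd]
    have := hg1 ⟨e, Submodule.mem_span_singleton_self e⟩
    rw [show (⟨1, one_mem_Pd⟩ : E) = e from rfl, this]
    have h2 := LinearPMap.mkSpanSingleton_apply (σ := RingHom.id ℝ) ℝ ℝ he (1 : ℝ)
    exact h2
  · intro f hf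
    rw [hLe f (K_le hq hp hw hc hf)]
    exact hg2 _ ⟨f, hf, fun _ _ => rfl⟩
  · intro f hf hz
    rw [hLe f hf]
    apply le_antisymm
    · have := hg2 (-⟨f, hf⟩) ⟨0, zero_mem _, fun σ hσ => by simp [hz σ hσ]⟩
      rw [map_neg] at this
      linarith
    · exact hg2 _ ⟨0, zero_mem _, fun σ hσ => by simp [hz σ hσ]⟩

/-- Set a literal to zero. -/
def set0 (x : Lit n) (σ : Fin n → Bool) : Fin n → Bool :=
  Sum.elim (fun i => Function.update σ i false) (fun i => Function.update σ i true) x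

lemma lit_set0_self (x : Lit n) (σ : Fin n → Bool) : lit x (set0 x σ) = 0 := by
  rcases x with i | i <;> simp [lit, set0]

lemma lit_set0_swap (x : Lit n) (σ : Fin n → Bool) : lit x.swap (set0 x σ) = 1 := by
  rcases x with i | i <;> simp [lit, set0]

lemma lit_set0_other (x v : Lit n) (hv : v ≠ x) (hv' : v ≠ x.swap) (σ : Fin n → Bool) :
    lit v (set0 x σ) = lit v σ := by
  rcases x with i | i <;> rcases v with j | j <;> simp at hv hv' <;> simp [lit, set0, hv, hv']

lemma mon_apply (T : Finset (Lit n)) (σ : Fin n → Bool) : mon T σ = ∏ v ∈ T, lit v σ := by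
  simp [mon]

lemma swap_ne (x : Lit n) : x.swap ≠ x := by rcases x with i | i <;> simp

lemma mon_set0_of_mem {x : Lit n} {T : Finset (Lit n)} (h : x ∈ T) (σ : Fin n → Bool) :
    mon T (set0 x σ) = 0 := by
  rw [mon_apply]; exact Finset.prod_eq_zero h (lit_set0_self x σ)

lemma mon_set0_of_notMem {x : Lit n} {T : Finset (Lit n)} (h : x ∉ T) (σ : Fin n → Bool) :
    mon T (set0 x σ) = mon (T.erase x.swap) σ := by
  rw [mon_apply, mon_apply]
  by_cases hs : x.swap ∈ T
  · rw [← Finset.mul_prod_erase T _ hs, lit_set0_swap, one_mul]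
    refine Finset.prod_congr rfl fun v hv => lit_set0_other x v ?_ (Finset.ne_of_mem_erase hv) σ
    rintro rfl; exact h (Finset.mem_of_mem_erase hv)
  · rw [Finset.erase_eq_of_notMem hs]
    refine Finset.prod_congr rfl fun v hv => lit_set0_other x v ?_ ?_ σ
    · rintro rfl; exact h hv
    · rintro rfl; exact hs hv

lemma L_mon_zero {E : ℕ} (L : CubeFun n →ₗ[ℝ] ℝ) (hL : ∀ r ∈ Pd n E, 0 ≤ L (r * r))
    {x : Lit n} (hx : L (lit x) = 0) {T : Finset (Lit n)} (hT : T.card ≤ 2 * E) (hxT : x ∈ T) :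
    L (mon T) = 0 := by
  have hE : 1 ≤ E := by
    have := Finset.card_pos.2 ⟨x, hxT⟩
    omega
  obtain ⟨T1, T2, hS, h1, h2, rfl⟩ := exists_split T hT {x} (by simpa using hxT) (by simpa using hE)
  have e1 := mon_sq T1
  have hx1 : lit x * mon T1 = mon T1 := by
    rw [← mon_insert, Finset.insert_eq_of_mem (by simpa using hS)]
  have m1 := mon_mem h1
  have m2 := mon_mem h2
  have a1 := hL _ m1
  rw [e1] at a1
  have a2 := hL _ (sub_mem (lit_mem_Pd hE x) m1)
  rw [show (lit x - mon T1) * (lit x - mon T1) = lit x - mon T1 by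
    linear_combination lit_sq x + e1 - 2 * hx1, map_sub, hx] at a2
  have a3 : L (mon T1) = 0 := by linarith
  have a4 : ∀ a : ℝ, 0 ≤ 2 * a * L (mon (T1 ∪ T2)) + L (mon T2) := by
    intro a
    have := hL _ (add_mem (Submodule.smul_mem _ a m1) m2)
    rw [show (a • mon T1 + mon T2) * (a • mon T1 + mon T2) =
      (a * a) • mon T1 + (2 * a) • mon (T1 ∪ T2) + mon T2 by
        rw [mon_union]
        funext σ
        have e1 := congrFun e1 σ
        have e2 := congrFun (mon_sq T2) σ
        simp at e1 e2 ⊢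
        linear_combination a ^ 2 * e1 + e2, map_add, map_add, map_smul, map_smul, a3] at this
    simpa using this
  by_contra hne
  have := a4 (-(L (mon T2) + 1) / (2 * L (mon (T1 ∪ T2))))
  have e : 2 * (-(L (mon T2) + 1) / (2 * L (mon (T1 ∪ T2)))) * L (mon (T1 ∪ T2))
      = -(L (mon T2) + 1) := by field_simp
  rw [e] at this
  linarith

lemma L_set0 {E : ℕ} (L : CubeFun n →ₗ[ℝ] ℝ) (hL : ∀ r ∈ Pd n E, 0 ≤ L (r * r))
    {x : Lit n} (hx : L (lit x) = 0) {f : CubeFun n} (hf : f ∈ Pd n (2 * E)) :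
    (fun σ => f (set0 x σ)) ∈ Pd n (2 * E) ∧ L f = L (fun σ => f (set0 x σ)) := by
  induction hf using Submodule.span_induction with
  | mem f hf =>
    obtain ⟨T, hT, rfl⟩ := hf
    by_cases h : x ∈ T
    · have : (fun σ => mon T (set0 x σ)) = 0 := by
        funext σ; exact mon_set0_of_mem h σ
      rw [this]
      exact ⟨zero_mem _, by rw [map_zero, L_mon_zero L hL hx hT h]⟩
    · have : (fun σ => mon T (set0 x σ)) = mon (T.erase x.swap) := by
        funext σ; exact mon_set0_of_notMem h σ
      rw [this]
      refine ⟨mon_mem ((Finset.card_erase_le).trans hT), ?_⟩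
      by_cases hs : x.swap ∈ T
      · have e1 : mon T = mon (T.erase x.swap) - mon (insert x (T.erase x.swap)) := by
          conv_lhs => rw [← Finset.insert_erase hs]
          rw [mon_insert, mon_insert, lit_swap]; ring
        have e2 : L (mon (insert x (T.erase x.swap))) = 0 := by
          refine L_mon_zero L hL hx ?_ (Finset.mem_insert_self _ _)
          refine (Finset.card_insert_le _ _).trans ?_
          rw [Finset.card_erase_add_one hs]; exact hT
        rw [e1, map_sub, e2, sub_zero]
      · rw [Finset.erase_eq_of_notMem hs]
  | zero => exact ⟨zero_mem _, rfl⟩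
  | add f g _ _ hf hg =>
    refine ⟨add_mem hf.1 hg.1, ?_⟩
    rw [map_add, hf.2, hg.2, ← map_add]; rfl
  | smul a f _ hf =>
    refine ⟨Submodule.smul_mem _ a hf.1, ?_⟩
    rw [map_smul, hf.2, ← map_smul]; rfl

/-- Merging two refutations. -/
lemma merge {k D : ℕ} (hq : ∀ j, (q j).totalDegree ≤ k)
    (hp : ∀ j, (p j).totalDegree ≤ k) (hw : 0 < w) (hc : k * w ≤ 2 * c)
    (A : Set (Fin n → Bool)) (x : Lit n) (hflip : ∀ σ ∈ A, set0 x σ ∈ A)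
    (h0 : Ref q p w c {σ | σ ∈ A ∧ lit x σ = 0} (D + 1))
    (h1 : Ref q p w c {σ | σ ∈ A ∧ lit x σ = 1} D) :
    Ref q p w c A (D + 1) := by
  by_contra hA
  obtain ⟨L, hL1, hLK, hLA⟩ := exists_functional hq hp hw hc A hA
  have hsq : ∀ r ∈ Pd n (D + 1 + c), 0 ≤ L (r * r) := fun r hr => hLK _ (sq_mem_K hr)
  have hx : 0 ≤ L (lit x) := by
    have := hsq _ (lit_mem_Pd (by omega) x)
    rwa [lit_sq] at this
  rcases hx.eq_or_lt with hx | hx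
  · obtain ⟨R, hR, hR0⟩ := h0
    have hm : 1 + R ∈ Pd n (2 * (D + 1 + c)) := add_mem one_mem_Pd (K_le hq hp hw hc hR)
    obtain ⟨h2, h3⟩ := L_set0 L hsq hx.symm hm
    rw [hLA _ h2 (fun σ hσ => by
      have := hR0 (set0 x σ) ⟨hflip σ hσ, lit_set0_self x σ⟩
      simp [this]), map_add, hL1] at h3
    have := hLK _ hR
    linarith
  · obtain ⟨R, hR, hR1⟩ := h1
    have h2 := lit_mul_K x hR
    have h3 : lit x + lit x * R ∈ Pd n (2 * (D + 1 + c)) :=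
      add_mem (lit_mem_Pd (by omega) x) (K_le hq hp hw hc h2)
    have h4 := hLA _ h3 (fun σ hσ => by
      rcases lit_zero_or_one x σ with h | h
      · simp [h]
      · simp [h, hR1 σ ⟨hσ, h⟩])
    rw [map_add] at h4
    have := hLK _ h2
    linarith

lemma K_mono {D E : ℕ} (h : D ≤ E) : K q p w c D ≤ K q p w c E := by
  apply AddSubmonoid.closure_mono
  rintro f (⟨r, hr, rfl⟩ | ⟨J, hJ, hJw, r, hr, rfl⟩ | ⟨j, t, ht, rfl⟩)
  · exact Or.inl ⟨r, Pd_mono (by omega) hr, rfl⟩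
  · exact Or.inr (Or.inl ⟨J, hJ, hJw, r, Pd_mono h hr, rfl⟩)
  · exact Or.inr (Or.inr ⟨j, t, Pd_mono (by omega) ht, rfl⟩)

lemma Ref_mono {A B : Set (Fin n → Bool)} (hBA : B ⊆ A) {D E : ℕ} (h : D ≤ E)
    (hR : Ref q p w c A D) : Ref q p w c B E := by
  obtain ⟨R, hR, h'⟩ := hR
  exact ⟨R, K_mono h hR, fun σ hσ => h' σ (hBA hσ)⟩

/-! ### Restrictions and wide monomials -/

/-- Points of the cube where all literals of `Z` vanish. -/
def sub (Z : Finset (Lit n)) : Set (Fin n → Bool) := {σ | ∀ v ∈ Z, lit v σ = 0}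

/-- What remains of a monomial after restricting. -/
def rest (Z T : Finset (Lit n)) : Finset (Lit n) := T \ Z.image Sum.swap

/-- The wide monomials surviving a restriction. -/
def wide (W : Finset (Finset (Lit n))) (d : ℕ) (Z : Finset (Lit n)) : Finset (Finset (Lit n)) :=
  W.filter fun T => Disjoint T Z ∧ d < (rest Z T).card

lemma wide_insert (W : Finset (Finset (Lit n))) (d : ℕ) (Z : Finset (Lit n)) (v : Lit n) :
    wide W d (insert v Z) ⊆ (wide W d Z).filter fun T => v ∉ T := by
  intro T hT
  simp only [wide, Finset.mem_filter, Finset.disjoint_insert_right] at hT ⊢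
  refine ⟨⟨hT.1, hT.2.1.2, hT.2.2.trans_le (Finset.card_le_card ?_)⟩, hT.2.1.1⟩
  apply Finset.sdiff_subset_sdiff le_rfl
  exact Finset.image_subset_image (Finset.subset_insert _ _)

lemma exists_popular (W : Finset (Finset (Lit n))) (d : ℕ) (Z : Finset (Lit n))
    (hne : (wide W d Z).Nonempty) :
    ∃ v : Lit n, v ∉ Z ∧ v.swap ∉ Z ∧
      (d + 1) * (wide W d Z).card ≤ 2 * (n + 1) * ((wide W d Z).filter fun T => v ∈ T).card := by
  set V := wide W d Z with hV
  have hcount : (d + 1) * V.card ≤ ∑ v : Lit n, (V.filter fun T => v ∈ rest Z T).card := by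
    have h1 : ∑ v : Lit n, (V.filter fun T => v ∈ rest Z T).card
        = ∑ T ∈ V, (rest Z T).card := by
      simp_rw [Finset.card_filter]
      rw [Finset.sum_comm]
      refine Finset.sum_congr rfl fun T _ => ?_
      simp
    rw [h1, mul_comm, ← smul_eq_mul]
    refine Finset.card_nsmul_le_sum _ _ _ fun T hT => ?_
    rw [hV, wide, Finset.mem_filter] at hT
    exact hT.2.2
  have hpos : 0 < V.card := Finset.card_pos.2 hne
  obtain ⟨v, hv⟩ : ∃ v : Lit n, (d + 1) * V.card ≤
      2 * (n + 1) * (V.filter fun T => v ∈ rest Z T).card := by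
    by_contra hcon
    push Not at hcon
    have : ∑ v : Lit n, 2 * (n + 1) * (V.filter fun T => v ∈ rest Z T).card ≤
        ∑ v : Lit n, (d + 1) * V.card := Finset.sum_le_sum fun v _ => (hcon v).le
    rw [← Finset.mul_sum, Finset.sum_const, Finset.card_univ, Fintype.card_sum, Fintype.card_fin,
      smul_eq_mul] at this
    have h2 := Nat.mul_le_mul_left (2 * (n + 1)) hcount
    have h3 : 0 < (d + 1) * V.card := by positivity
    nlinarith
  have hpos2 : 0 < (V.filter fun T => v ∈ rest Z T).card := by
    by_contra h
    have h0 : (V.filter fun T => v ∈ rest Z T).card = 0 := by omega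
    rw [h0, mul_zero] at hv
    have h3 : 0 < (d + 1) * V.card := by positivity
    omega
  obtain ⟨T, hT⟩ := Finset.card_pos.1 hpos2
  rw [Finset.mem_filter] at hT
  obtain ⟨hTV, hvT⟩ := hT
  rw [hV, wide, Finset.mem_filter] at hTV
  rw [rest, Finset.mem_sdiff] at hvT
  refine ⟨v, Finset.disjoint_left.1 hTV.2.1 hvT.1, fun h => hvT.2 ?_, hv.trans ?_⟩
  · exact Finset.mem_image.2 ⟨_, h, Sum.swap_swap v⟩
  · apply Nat.mul_le_mul_left
    apply Finset.card_le_card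
    intro T hT
    rw [Finset.mem_filter] at hT ⊢
    exact ⟨hT.1, (Finset.mem_sdiff.1 hT.2).1⟩

lemma sub_flip (Z : Finset (Lit n)) (v : Lit n) (h2 : v.swap ∉ Z) (σ : Fin n → Bool)
    (hσ : σ ∈ sub Z) : set0 v σ ∈ sub Z := by
  intro u hu
  by_cases h : u = v
  · rw [h]; exact lit_set0_self v σ
  · rw [lit_set0_other v u h (by rintro rfl; exact h2 hu)]
    exact hσ u hu

lemma main_ind {k d : ℕ} (hq : ∀ j, (q j).totalDegree ≤ k)
    (hp : ∀ j, (p j).totalDegree ≤ k) (hw : 0 < w) (hc : k * w ≤ 2 * c)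
    (W : Finset (Finset (Lit n)))
    (hbase : ∀ Z, wide W d Z = ∅ → Ref q p w c (sub Z) d) :
    ∀ (b f : ℕ) (Z : Finset (Lit n)), 2 * n ≤ Z.card + f →
      ((wide W d Z).card : ℝ) * Real.exp (-(((d : ℝ) + 1) / (2 * (n + 1))) * b) < 1 →
      Ref q p w c (sub Z) (d + b) := by
  intro b
  induction b with
  | zero =>
    intro f Z _ h
    apply hbase
    simp at h
    exact h
  | succ b ihb =>
    intro f
    induction f with
    | zero =>
      intro Z hZ _
      rcases (wide W d Z).eq_empty_or_nonempty with h | h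
      · exact Ref_mono le_rfl (by omega) (hbase Z h)
      · obtain ⟨v, hv, -, -⟩ := exists_popular W d Z h
        exfalso
        have : Z = Finset.univ := by
          apply Finset.eq_univ_of_card
          apply le_antisymm (Finset.card_le_univ _)
          simp; omega
        exact hv (this ▸ Finset.mem_univ v)
    | succ f ihf =>
      intro Z hZ hsmall
      rcases (wide W d Z).eq_empty_or_nonempty with h | h
      · exact Ref_mono le_rfl (by omega) (hbase Z h)
      obtain ⟨v, hv, hv', hpop⟩ := exists_popular W d Z h
      have key0 : Ref q p w c (sub (insert v Z)) (d + b) := by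
        apply ihb (2 * n) _ (by omega)
        have h1 : (wide W d (insert v Z)).card + ((wide W d Z).filter fun T => v ∈ T).card
            ≤ (wide W d Z).card := by
          have := Finset.card_le_card (wide_insert W d Z v)
          have h2 := Finset.card_filter_add_card_filter_not (s := wide W d Z) (fun T => v ∈ T)
          omega
        have h1' : ((wide W d (insert v Z)).card : ℝ) +
            (((wide W d Z).filter fun T => v ∈ T).card : ℝ) ≤ (wide W d Z).card := by
          exact_mod_cast h1
        have hpop' : ((d : ℝ) + 1) * (wide W d Z).card ≤
            2 * (n + 1) * (((wide W d Z).filter fun T => v ∈ T).card : ℝ) := by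
          exact_mod_cast hpop
        set a : ℝ := ((d : ℝ) + 1) / (2 * (n + 1)) with ha
        have hn : (0 : ℝ) < 2 * (n + 1) := by positivity
        have h3 : a * (wide W d Z).card ≤ (((wide W d Z).filter fun T => v ∈ T).card : ℝ) := by
          rw [ha, div_mul_eq_mul_div, div_le_iff₀ hn]; linarith
        have h4 : ((wide W d (insert v Z)).card : ℝ) ≤ (wide W d Z).card * Real.exp (-a) := by
          have := Real.add_one_le_exp (-a)
          have h5 : (0 : ℝ) ≤ (wide W d Z).card := by positivity
          nlinarith
        refine lt_of_le_of_lt ?_ hsmall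
        calc _ ≤ (wide W d Z).card * Real.exp (-a) * Real.exp (-a * b) := by gcongr
          _ = _ := by
            rw [mul_assoc, ← Real.exp_add]
            congr 2
            push_cast; ring
      have key1 : Ref q p w c (sub (insert v.swap Z)) (d + b + 1) := by
        apply ihf _ (by rw [Finset.card_insert_of_notMem hv']; omega)
        refine lt_of_le_of_lt ?_ hsmall
        gcongr
        exact (wide_insert W d Z v.swap).trans (Finset.filter_subset _ _)
      refine merge hq hp hw hc (sub Z) v.swap
        (sub_flip Z v.swap (by rwa [Sum.swap_swap])) ?_ ?_
      · refine Ref_mono ?_ le_rfl key1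
        rintro σ ⟨hσ, hx⟩ u hu
        rcases Finset.mem_insert.1 hu with rfl | hu
        · exact hx
        · exact hσ u hu
      · refine Ref_mono ?_ le_rfl key0
        rintro σ ⟨hσ, hx⟩ u hu
        rcases Finset.mem_insert.1 hu with rfl | hu
        · rw [lit_swap] at hx
          simpa using hx
        · exact hσ u hu

/-! ### From a refutation without wide monomials to a low-degree one -/

/-- The monomials of a polynomial. -/
def mons (f : MvPoly n) : Finset (Finset (Lit n)) := f.support.image Finsupp.support

lemma approx {W : Finset (Finset (Lit n))} {d : ℕ} {Z : Finset (Lit n)} (hW : wide W d Z = ∅)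
    (f : MvPoly n) (hf : mons f ⊆ W) :
    ∃ g ∈ Pd n d, ∀ σ ∈ sub Z, g σ = ev f σ := by
  have h1 : ∀ T ∈ W, ∃ g ∈ Pd n d, ∀ σ ∈ sub Z, g σ = mon T σ := by
    intro T hT
    by_cases hd : Disjoint T Z
    · have hc : (rest Z T).card ≤ d := by
        by_contra hlt
        have : T ∈ wide W d Z := Finset.mem_filter.2 ⟨hT, hd, by omega⟩
        rw [hW] at this
        simp at this
      refine ⟨mon (rest Z T), mon_mem hc, fun σ hσ => ?_⟩
      rw [mon_apply, mon_apply]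
      apply Finset.prod_subset Finset.sdiff_subset
      intro v hv hv'
      have : v ∈ Z.image Sum.swap := by
        by_contra h
        exact hv' (Finset.mem_sdiff.2 ⟨hv, h⟩)
      obtain ⟨u, hu, rfl⟩ := Finset.mem_image.1 this
      rw [lit_swap, Pi.sub_apply, hσ u hu]
      simp
    · obtain ⟨v, hv, hv'⟩ := Finset.not_disjoint_iff.1 hd
      refine ⟨0, zero_mem _, fun σ hσ => ?_⟩
      rw [mon_apply]
      exact (Finset.prod_eq_zero (f := fun v => lit v σ) hv (hσ v hv')).symm
  choose! G hG hG' using h1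
  have hW' : ∀ m ∈ f.support, m.support ∈ W := fun m hm => hf (Finset.mem_image_of_mem _ hm)
  refine ⟨∑ m ∈ f.support, coeff m f • G m.support,
    Submodule.sum_mem _ fun m hm => Submodule.smul_mem _ _ (hG _ (hW' m hm)), fun σ hσ => ?_⟩
  rw [ev_eq_sum, Finset.sum_apply, Finset.sum_apply]
  refine Finset.sum_congr rfl fun m hm => ?_
  rw [Pi.smul_apply, Pi.smul_apply, hG' _ (hW' m hm) σ hσ]

lemma approx_sos {W : Finset (Finset (Lit n))} {d : ℕ} {Z : Finset (Lit n)}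
    (hW : wide W d Z = ∅) (M : AddSubmonoid (CubeFun n)) (P : CubeFun n)
    (hP : ∀ g ∈ Pd n d, g * g * P ∈ M) (l : List (MvPoly n)) (hl : ∀ f ∈ l, mons f ⊆ W) :
    ∃ R ∈ M, ∀ σ ∈ sub Z, R σ = ev (sosOf l) σ * P σ := by
  induction l with
  | nil => exact ⟨0, zero_mem _, fun σ _ => by simp [sosOf]⟩
  | cons f l ih =>
    obtain ⟨R, hR, hR'⟩ := ih fun g hg => hl g (List.mem_cons_of_mem _ hg)
    obtain ⟨g, hg, hg'⟩ := approx hW f (hl f List.mem_cons_self)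
    refine ⟨g * g * P + R, add_mem (hP g hg) hR, fun σ hσ => ?_⟩
    have : ev (sosOf (f :: l)) = ev f * ev f + ev (sosOf l) := by
      simp [sosOf, sq]
    rw [this]
    simp only [Pi.add_apply, Pi.mul_apply, hR' σ hσ, hg' σ hσ]
    ring

/-- All monomials of a proof. -/
def allMons (π : PSProof n ℓ m q p (-1)) : Finset (Finset (Lit n)) :=
  π.r0.toFinset.biUnion mons ∪ (π.Js.biUnion fun J => (π.r J).toFinset.biUnion mons) ∪
    Finset.univ.biUnion fun j => mons (π.t j)

lemma card_list_mons (l : List (MvPoly n)) :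
    (l.toFinset.biUnion mons).card ≤ (l.map fun r => r.support.card).sum := by
  induction l with
  | nil => simp
  | cons f l ih =>
    rw [List.toFinset_cons, Finset.biUnion_insert, List.map_cons, List.sum_cons]
    exact (Finset.card_union_le _ _).trans (add_le_add Finset.card_image_le ih)

lemma card_allMons (π : PSProof n ℓ m q p (-1)) : (allMons π).card ≤ π.size := by
  unfold allMons PSProof.size
  refine (Finset.card_union_le _ _).trans (add_le_add ?_ ?_)
  · refine (Finset.card_union_le _ _).trans (add_le_add (card_list_mons _) ?_)
    exact Finset.card_biUnion_le.trans (Finset.sum_le_sum fun J _ => card_list_mons _)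
  · exact Finset.card_biUnion_le.trans (Finset.sum_le_sum fun J _ => Finset.card_image_le)

lemma base (π : PSProof n ℓ m q p (-1)) (hπ : π.widthLE w) (d : ℕ) (Z : Finset (Lit n))
    (hW : wide (allMons π) d Z = ∅) : Ref q p w c (sub Z) d := by
  obtain ⟨R0, hR0, hR0'⟩ := approx_sos hW (K q p w c d) 1
    (fun g hg => by rw [mul_one]; exact sq_mem_K (Pd_mono (by omega) hg)) π.r0 (fun f hf => by
      intro T hT
      simp only [allMons, Finset.mem_union, Finset.mem_biUnion, List.mem_toFinset]
      exact Or.inl (Or.inl ⟨f, hf, hT⟩))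
  have h1 : ∀ J ∈ π.Js, ∃ R ∈ K q p w c d, ∀ σ ∈ sub Z,
      R σ = ev (sosOf (π.r J)) σ * (∏ j ∈ J, ev (q j)) σ := by
    intro J hJ
    refine approx_sos hW (K q p w c d) _ (fun g hg => AddSubmonoid.subset_closure
      (Or.inr (Or.inl ⟨J, ?_, hπ J hJ, g, hg, rfl⟩))) (π.r J) (fun f hf => ?_)
    · rw [Finset.nonempty_iff_ne_empty]
      rintro rfl
      exact π.empty_not_mem hJ
    · intro T hT
      simp only [allMons, Finset.mem_union, Finset.mem_biUnion, List.mem_toFinset]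
      exact Or.inl (Or.inr ⟨J, hJ, f, hf, hT⟩)
  have h2 : ∀ j, ∃ g ∈ Pd n d, ∀ σ ∈ sub Z, g σ = ev (π.t j) σ := by
    intro j
    refine approx hW _ fun T hT => ?_
    simp only [allMons, Finset.mem_union, Finset.mem_biUnion]
    exact Or.inr ⟨j, Finset.mem_univ j, hT⟩
  choose! RJ hRJ hRJ' using h1
  choose t ht ht' using h2
  refine ⟨R0 + ∑ J ∈ π.Js, RJ J + ∑ j, t j * ev (p j),
    add_mem (add_mem hR0 (sum_mem hRJ)) (sum_mem fun j _ => AddSubmonoid.subset_closure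
      (Or.inr (Or.inr ⟨j, t j, Pd_mono (by omega) (ht j), rfl⟩))), fun σ hσ => ?_⟩
  have hid := congrArg (fun f => ev f σ) π.identity
  simp only [map_add, map_sum, map_mul, map_prod, ev_boolAxiom, mul_zero, Finset.sum_const_zero,
    add_zero, map_neg, map_one] at hid
  simp only [Pi.add_apply, Finset.sum_apply, Pi.mul_apply, Pi.neg_apply, Pi.one_apply] at hid ⊢
  rw [hid, hR0' σ hσ]
  simp only [Pi.one_apply, mul_one]
  congr 1
  · congr 1
    exact Finset.sum_congr rfl fun J hJ => by rw [hRJ' J hJ σ hσ]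
  · exact Finset.sum_congr rfl fun j _ => by rw [ht' j σ hσ]

/-! ### Reading off a proof -/

lemma sosOf_append (l l' : List (MvPoly n)) : sosOf (l ++ l') = sosOf l + sosOf l' := by
  simp [sosOf]

lemma sosOf_deg {l : List (MvPoly n)} {d : ℕ} (h : ∀ f ∈ l, f.totalDegree ≤ d) :
    (sosOf l).totalDegree ≤ 2 * d := by
  induction l with
  | nil => simp [sosOf]
  | cons f l ih =>
    have : sosOf (f :: l) = f ^ 2 + sosOf l := by simp [sosOf]
    rw [this]
    refine (totalDegree_add _ _).trans (max_le ?_ (ih fun g hg => h g (List.mem_cons_of_mem _ hg)))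
    exact (totalDegree_pow _ _).trans (Nat.mul_le_mul_left 2 (h f List.mem_cons_self))

/-- The index sets of width at most `w`. -/
def allJs (ℓ w : ℕ) : Finset (Finset (Fin ℓ)) :=
  Finset.univ.filter fun J => J.Nonempty ∧ J.card ≤ w

lemma read_off {D : ℕ} {f : CubeFun n} (hf : f ∈ K q p w c D) :
    ∃ (r0 : List (MvPoly n)) (r : Finset (Fin ℓ) → List (MvPoly n)) (t : Fin m → MvPoly n),
      (∀ g ∈ r0, g.totalDegree ≤ D + c) ∧ (∀ J, ∀ g ∈ r J, g.totalDegree ≤ D) ∧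
      (∀ j, (t j).totalDegree ≤ 2 * D) ∧
      f = ev (sosOf r0 + ∑ J ∈ allJs ℓ w, sosOf (r J) * ∏ j ∈ J, q j + ∑ j, t j * p j) := by
  induction hf using AddSubmonoid.closure_induction with
  | mem f hf =>
    rcases hf with ⟨r, hr, rfl⟩ | ⟨J, hJ, hJw, r, hr, rfl⟩ | ⟨j, t, ht, rfl⟩
    · obtain ⟨g, hg, rfl⟩ := exists_poly hr
      refine ⟨[g], fun _ => [], fun _ => 0, by simpa using hg, by simp, by simp, ?_⟩
      simp [sosOf, sq]
    · obtain ⟨g, hg, rfl⟩ := exists_poly hr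
      refine ⟨[], fun J' => if J' = J then [g] else [], fun _ => 0, by simp, ?_, by simp, ?_⟩
      · intro J' g' hg'
        by_cases h : J' = J
        · simp [h] at hg'; rw [hg']; exact hg
        · simp [h] at hg'
      · have hmem : J ∈ allJs ℓ w := by simp [allJs, hJ, hJw]
        rw [Finset.sum_eq_single_of_mem J hmem]
        · simp [sosOf, sq]
        · intro J' _ h
          simp [h, sosOf]
    · obtain ⟨g, hg, rfl⟩ := exists_poly ht
      refine ⟨[], fun _ => [], fun j' => if j' = j then g else 0, by simp, by simp, ?_, ?_⟩
      · intro j'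
        by_cases h : j' = j
        · simp [h, hg]
        · simp [h]
      · simp [sosOf]
  | zero => exact ⟨[], fun _ => [], fun _ => 0, by simp, by simp, by simp, by simp [sosOf]⟩
  | add f g _ _ hf hg =>
    obtain ⟨r0, r, t, h1, h2, h3, rfl⟩ := hf
    obtain ⟨r0', r', t', h1', h2', h3', rfl⟩ := hg
    refine ⟨r0 ++ r0', fun J => r J ++ r' J, fun j => t j + t' j, ?_, ?_, ?_, ?_⟩
    · intro g hg
      rcases List.mem_append.1 hg with h | h
      exacts [h1 g h, h1' g h]
    · intro J g hg
      rcases List.mem_append.1 hg with h | h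
      exacts [h2 J g h, h2' J g h]
    · exact fun j => (totalDegree_add _ _).trans (max_le (h3 j) (h3' j))
    · rw [← map_add]
      congr 1
      simp only [sosOf_append, add_mul, Finset.sum_add_distrib]
      ring

lemma to_proof {k D : ℕ} (hq : ∀ j, (q j).totalDegree ≤ k)
    (hp : ∀ j, (p j).totalDegree ≤ k) (hw : 0 < w) (hR : Ref q p w c (sub ∅) D) {d : ℕ}
    (hd1 : 2 * (D + c) ≤ d) (hd2 : 2 * D + k * w ≤ d) :
    ∃ π : PSProof n ℓ m q p (-1), π.widthLE w ∧ π.degreeLE d := by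
  obtain ⟨R, hR, hR'⟩ := hR
  obtain ⟨r0, r, t, h1, h2, h3, rfl⟩ := read_off hR
  set S := sosOf r0 + ∑ J ∈ allJs ℓ w, sosOf (r J) * ∏ j ∈ J, q j + ∑ j, t j * p j with hS
  obtain ⟨u, hu⟩ := nullstellensatz (-1 - S) (by
    funext σ
    have := hR' σ (by simp [sub])
    simp [this])
  refine ⟨⟨allJs ℓ w, by simp [allJs], r0, r, t, u, ?_⟩, ?_, ?_, ?_, ?_, ?_⟩
  · rw [← hu, ← hS]; ring
  · intro J hJ
    simp only [allJs, Finset.mem_filter] at hJ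
    exact hJ.2.2
  · simp
  · exact (sosOf_deg h1).trans hd1
  · intro J hJ _
    simp only [allJs, Finset.mem_filter] at hJ
    have e1 := sosOf_deg (h2 J)
    have e2 : ∑ j ∈ J, (q j).totalDegree ≤ J.card * k := by
      rw [← smul_eq_mul]; exact Finset.sum_le_card_nsmul _ _ _ fun j _ => hq j
    have e3 := Nat.mul_le_mul_right k hJ.2.2
    rw [mul_comm w k] at e3
    exact (add_le_add e1 (e2.trans e3)).trans hd2
  · intro j _
    have := Nat.mul_le_mul_left k (Nat.succ_le_of_lt hw)
    rw [Nat.succ_eq_add_one, zero_add, mul_one] at this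
    exact (add_le_add (h3 j) ((hp j).trans this)).trans hd2

end cone

end PSAux

/-- **Theorem 1 (size-degree trade-off for PS).** If a system of polynomials of degree
at most `k` on `n` pairs of twin variables has a PS refutation of product-width at
most `w` and monomial size at most `s`, then it has a PS refutation of product-width
at most `w` and degree at most `4√(2(n+1)·log s) + k·w + 4`. -/
theorem statement0 (n k : ℕ) (ℓ m : ℕ) (q : Fin ℓ → MvPoly n) (p : Fin m → MvPoly n)
    (hq : ∀ j, (q j).totalDegree ≤ k) (hp : ∀ j, (p j).totalDegree ≤ k)
    (s w : ℕ) (hs : 0 < s) (hw : 0 < w)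
    (h : ∃ π : PSProof n ℓ m q p (-1), π.size ≤ s ∧ π.widthLE w) :
    ∃ π : PSProof n ℓ m q p (-1), π.widthLE w ∧ ∃ d : ℕ,
      (d : ℝ) ≤ 4 * Real.sqrt (2 * (n + 1) * Real.log s) + k * w + 4 ∧
      π.degreeLE d := by
  obtain ⟨π, hsize, hπ⟩ := h
  set y : ℝ := Real.sqrt (2 * (n + 1) * Real.log s) with hy
  have hlog : 0 ≤ Real.log s := Real.log_natCast_nonneg s
  have hnn : (0 : ℝ) ≤ 2 * (n + 1) * Real.log s := by positivity
  have hysq : y ^ 2 = 2 * (n + 1) * Real.log s := Real.sq_sqrt hnn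
  have hy0 : 0 ≤ y := Real.sqrt_nonneg _
  set d := ⌊y⌋₊ with hd
  have hdle : (d : ℝ) ≤ y := Nat.floor_le hy0
  have hdlt : y < d + 1 := Nat.lt_floor_add_one y
  have hc : k * w ≤ 2 * ((k * w + 1) / 2) := by omega
  have hRef : PSAux.Ref q p w ((k * w + 1) / 2) (PSAux.sub ∅) (d + (d + 1)) := by
    refine PSAux.main_ind hq hp hw hc (PSAux.allMons π)
      (fun Z hZ => PSAux.base π hπ d Z hZ) (d + 1) (2 * n) ∅ (by omega) ?_
    have h1 : ((PSAux.wide (PSAux.allMons π) d ∅).card : ℝ) ≤ s := by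
      exact_mod_cast (Finset.card_le_card (Finset.filter_subset _ _)).trans
        ((PSAux.card_allMons π).trans hsize)
    have hs' : (0 : ℝ) < s := by exact_mod_cast hs
    have hn : (0 : ℝ) < 2 * (n + 1) := by positivity
    have h2 : Real.log s < (d + 1) / (2 * (n + 1)) * ((d + 1 : ℕ) : ℝ) := by
      push_cast
      rw [div_mul_eq_mul_div, lt_div_iff₀ hn]
      nlinarith
    calc _ ≤ (s : ℝ) * Real.exp (-((d + 1) / (2 * (n + 1))) * ((d + 1 : ℕ) : ℝ)) := by gcongr
      _ < s * Real.exp (- Real.log s) := by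
        gcongr
        linarith
      _ = 1 := by
        rw [Real.exp_neg, Real.exp_log hs']
        field_simp
  obtain ⟨π', h1, h2⟩ := PSAux.to_proof hq hp hw hRef
    (d := 2 * (d + (d + 1)) + k * w + 1) (by omega) (by omega)
  refine ⟨π', h1, _, ?_, h2⟩
  push_cast
  linarith
end
end

section
/- Let d be a positive integer, let Q be an indexed set of polynomials on n pairs of twin variables, let c be a cut-off function for Q, let w be a positive integer, and let p be a polynomial of degree at most 2d. Then sup{r ∈ ℝ : Q ⊢^c_{w,2d} p ≥ r} = inf{E(p) : E ∈ ℰ^c_{w,2d}(Q)} (as elements of ℝ ∪ {±∞}). Moreover, if the set ℰ^c_{w,2d}(Q) is nonempty, then there is a pseudo-expectation achieving the infimum, i.e., min{E(p) : E ∈ ℰ^c_{w,2d}(Q)} is well-defined. -/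
open MvPolynomial

noncomputable section

/-- A cut-off function for the system `q, p`. -/
def IsCutoff {n ℓ m : ℕ} (q : Fin ℓ → MvPoly n) (p : Fin m → MvPoly n)
    (c : Finset (Fin ℓ) ⊕ Fin m → ℕ) : Prop :=
  (∀ J : Finset (Fin ℓ), ∑ j ∈ J, (q j).totalDegree ≤ c (Sum.inl J)) ∧
  (∀ j : Fin m, (p j).totalDegree ≤ c (Sum.inr j))

/-- The proof has degree mod `c` at most `d`. -/
def PSProof.degreeModLE {n ℓ m : ℕ} {q : Fin ℓ → MvPoly n} {p : Fin m → MvPoly n}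
    {goal : MvPoly n} (π : PSProof n ℓ m q p goal)
    (c : Finset (Fin ℓ) ⊕ Fin m → ℕ) (d : ℕ) : Prop :=
  goal.totalDegree ≤ d ∧ (sosOf π.r0).totalDegree ≤ d ∧
  (∀ J ∈ π.Js, sosOf (π.r J) ≠ 0 → (sosOf (π.r J)).totalDegree + c (Sum.inl J) ≤ d) ∧
  (∀ j, π.t j ≠ 0 → (π.t j).totalDegree + c (Sum.inr j) ≤ d)

/-- `PS^c_{w,d}(Q)`: polynomials of degree at most `d` with a PS proof of
degree mod `c` at most `d` and product-width at most `w`.  `Q ⊢^c_{w,d} a ≥ b`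
is expressed as `a - b ∈ PScone …`. -/
def PScone (n ℓ m : ℕ) (q : Fin ℓ → MvPoly n) (p : Fin m → MvPoly n)
    (c : Finset (Fin ℓ) ⊕ Fin m → ℕ) (w d : ℕ) : Set (MvPoly n) :=
  {g | g.totalDegree ≤ d ∧ ∃ π : PSProof n ℓ m q p g, π.degreeModLE c d ∧ π.widthLE w}

/-- `ℰ^c_{w,d}(Q)`: pseudo-expectations, i.e. linear functionals on the space of
polynomials of degree at most `d` sending `1` to `1` and the cone to nonnegatives. -/
def PseudoExp (n ℓ m : ℕ) (q : Fin ℓ → MvPoly n) (p : Fin m → MvPoly n)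
    (c : Finset (Fin ℓ) ⊕ Fin m → ℕ) (w d : ℕ) :
    Set ((restrictTotalDegree (Fin n ⊕ Fin n) ℝ d) →ₗ[ℝ] ℝ) :=
  {E | (∀ g : restrictTotalDegree (Fin n ⊕ Fin n) ℝ d, (g : MvPoly n) = 1 → E g = 1) ∧
    (∀ g : restrictTotalDegree (Fin n ⊕ Fin n) ℝ d,
      (g : MvPoly n) ∈ PScone n ℓ m q p c w d → 0 ≤ E g)}

section helpers

/-- Abstract conic duality with an order unit. -/
theorem abstract_duality {V : Type*} [AddCommGroup V] [Module ℝ V] (K : PointedCone ℝ V)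
    (e : V) (he : e ∈ K) (hu : ∀ x : V, ∃ r : ℝ, r • e + x ∈ K) (hne : -e ∉ K) (P : V) :
    ∃ (s : ℝ) (g : V →ₗ[ℝ] ℝ), IsLUB {r : ℝ | P - r • e ∈ K} s ∧ g e = 1 ∧
      (∀ x ∈ K, 0 ≤ g x) ∧ g P = s := by
  have hsm : ∀ (a : ℝ), 0 ≤ a → ∀ x ∈ K, a • x ∈ K := fun a ha x hx =>
    K.smul_mem ha hx
  have hneg : ∀ a : ℝ, a • e ∈ K → 0 ≤ a := by
    intro a ha
    by_contra h
    push Not at h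
    apply hne
    have := hsm (-a)⁻¹ (by rw [inv_nonneg]; linarith) _ ha
    rw [smul_smul] at this
    have h2 : (-a)⁻¹ * a = -1 := by
      rw [inv_neg, neg_mul, inv_mul_cancel₀ h.ne]
    rw [h2] at this
    simpa using this
  have he0 : e ≠ 0 := by
    rintro rfl
    apply hne
    simp
  set S : Set ℝ := {r : ℝ | P - r • e ∈ K} with hS
  have hSne : S.Nonempty := by
    obtain ⟨r, hr⟩ := hu P
    refine ⟨-r, ?_⟩
    show P - (-r) • e ∈ K
    have : P - (-r) • e = r • e + P := by module
    rwa [this]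
  have hSb : BddAbove S := by
    obtain ⟨r, hr⟩ := hu (-P)
    refine ⟨r, fun a ha => ?_⟩
    have h1 := K.add_mem hr ha
    have : r • e + -P + (P - a • e) = (r - a) • e := by module
    rw [this] at h1
    linarith [hneg _ h1]
  have hlub := isLUB_csSup hSne hSb
  set s := sSup S
  let K' : PointedCone ℝ V :=
    { carrier := {x | ∃ k ∈ K, ∃ t : ℝ, 0 ≤ t ∧ x = k + t • (s • e - P)}
      zero_mem' := ⟨0, K.zero_mem, 0, le_rfl, by simp⟩
      add_mem' := by
        rintro _ _ ⟨k, hk, t, ht, rfl⟩ ⟨k', hk', t', ht', rfl⟩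
        exact ⟨k + k', K.add_mem hk hk', t + t', add_nonneg ht ht', by module⟩
      smul_mem' := by
        rintro ⟨a, ha⟩ _ ⟨k, hk, t, ht, rfl⟩
        refine ⟨a • k, hsm a ha k hk, a * t, mul_nonneg ha ht, ?_⟩
        show a • (k + t • (s • e - P)) = _
        module }
  have hKK' : ∀ k ∈ K, k ∈ K' := fun k hk => ⟨k, hk, 0, le_rfl, by simp⟩
  have hneg' : ∀ a : ℝ, a • e ∈ K' → 0 ≤ a := by
    rintro a ⟨k, hk, t, ht, hat⟩
    rcases ht.eq_or_lt with rfl | ht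
    · apply hneg
      rw [hat]; simpa using hk
    · have h1 := hsm t⁻¹ (by positivity) k hk
      have h2 : k = a • e - t • (s • e - P) := by rw [hat]; abel
      have h3 : t⁻¹ • k = P - (s - t⁻¹ * a) • e := by
        rw [h2, smul_sub, smul_smul t⁻¹ t, inv_mul_cancel₀ ht.ne']
        module
      rw [h3] at h1
      have h4 := hlub.1 h1
      have h5 : 0 ≤ t⁻¹ * a := by linarith
      have h6 : 0 < t⁻¹ := by positivity
      exact nonneg_of_mul_nonneg_right h5 h6
  obtain ⟨g, hg1, hg2⟩ := riesz_extension K'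
    (LinearPMap.mkSpanSingleton e (1 : ℝ) he0 : V →ₗ.[ℝ] ℝ)
    (by
      rintro ⟨x, hx⟩ hxK
      obtain ⟨a, rfl⟩ := Submodule.mem_span_singleton.1 hx
      rw [LinearPMap.mkSpanSingleton'_apply]
      simpa using hneg' a hxK)
    (by
      intro y
      obtain ⟨r, hr⟩ := hu y
      exact ⟨⟨r • e, Submodule.mem_span_singleton.2 ⟨r, rfl⟩⟩, hKK' _ hr⟩)
  have hge : g e = 1 := by
    have := hg1 ⟨e, Submodule.mem_span_singleton_self e⟩
    exact this.trans (LinearPMap.mkSpanSingleton_apply ℝ ℝ he0 (1 : ℝ))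
  refine ⟨s, g, hlub, hge, fun x hx => hg2 x (hKK' x hx), le_antisymm ?_ ?_⟩
  · have := hg2 (s • e - P) ⟨0, K.zero_mem, 1, zero_le_one, by simp⟩
    simp [hge] at this
    linarith
  · refine hlub.2 fun r hr => ?_
    have := hg2 _ (hKK' _ hr)
    simp [hge] at this
    linarith

variable {n ℓ m : ℕ} {q : Fin ℓ → MvPoly n} {p : Fin m → MvPoly n}
  {c : Finset (Fin ℓ) ⊕ Fin m → ℕ} {w D : ℕ}

theorem sosOf_append (l l' : List (MvPoly n)) : sosOf (l ++ l') = sosOf l + sosOf l' := by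
  simp [sosOf]

theorem sosOf_nil : sosOf ([] : List (MvPoly n)) = 0 := by simp [sosOf]

theorem sosOf_scale (a : ℝ) (ha : 0 ≤ a) (l : List (MvPoly n)) :
    sosOf (l.map (C (Real.sqrt a) * ·)) = C a * sosOf l := by
  induction l with
  | nil => simp [sosOf]
  | cons x l ih =>
    simp only [sosOf, List.map_cons, List.sum_cons] at ih ⊢
    rw [ih, mul_pow, ← C_pow, Real.sq_sqrt ha]
    ring

theorem totalDegree_C_mul_le (a : ℝ) (f : MvPoly n) : (C a * f).totalDegree ≤ f.totalDegree := by
  rw [← smul_eq_C_mul]; exact totalDegree_smul_le a f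

theorem deg_add_aux {f g : MvPoly n} {k : ℕ} (hf : f ≠ 0 → f.totalDegree + k ≤ D)
    (hg : g ≠ 0 → g.totalDegree + k ≤ D) (h : f + g ≠ 0) : (f + g).totalDegree + k ≤ D := by
  by_cases hf0 : f = 0
  · subst hf0; rw [zero_add] at h ⊢; exact hg h
  by_cases hg0 : g = 0
  · subst hg0; rw [add_zero] at h ⊢; exact hf h
  have := totalDegree_add f g
  have h1 := hf hf0
  have h2 := hg hg0
  rcases max_choice f.totalDegree g.totalDegree with h | h <;> omega

/-- Convenient normal form of cone membership. -/
theorem mem_PScone_iff {g : MvPoly n} : g ∈ PScone n ℓ m q p c w D ↔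
    g.totalDegree ≤ D ∧ ∃ (r0 : List (MvPoly n)) (r : Finset (Fin ℓ) → List (MvPoly n))
      (t : Fin m → MvPoly n) (u : Fin 3 × Fin n → MvPoly n),
      g = sosOf r0 + ∑ J, sosOf (r J) * ∏ j ∈ J, q j
        + ∑ j, t j * p j + ∑ a, u a * boolAxiom n a ∧
      (sosOf r0).totalDegree ≤ D ∧
      (∀ J, sosOf (r J) ≠ 0 → (sosOf (r J)).totalDegree + c (Sum.inl J) ≤ D) ∧
      (∀ j, t j ≠ 0 → (t j).totalDegree + c (Sum.inr j) ≤ D) ∧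
      (∀ J, ¬ (J ≠ ∅ ∧ J.card ≤ w) → r J = []) := by
  classical
  constructor
  · rintro ⟨hg, π, ⟨-, h1, h2, h3⟩, hw⟩
    refine ⟨hg, π.r0, fun J => if J ∈ π.Js then π.r J else [], π.t, π.u, ?_, h1, ?_, h3, ?_⟩
    · conv_lhs => rw [π.identity]
      congr 3
      rw [← Finset.sum_subset (Finset.subset_univ π.Js)]
      · exact Finset.sum_congr rfl fun J hJ => by simp [hJ]
      · intro J _ hJ
        simp [hJ, sosOf_nil]
    · intro J
      by_cases hJ : J ∈ π.Js
      · simpa [hJ] using h2 J hJ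
      · simp [hJ, sosOf_nil]
    · intro J hJ
      apply if_neg
      intro hJ'
      exact hJ ⟨fun h => π.empty_not_mem (h ▸ hJ'), hw J hJ'⟩
  · rintro ⟨hg, r0, r, t, u, hid, h1, h2, h3, h4⟩
    refine ⟨hg, ⟨Finset.univ.filter fun J => J ≠ ∅ ∧ J.card ≤ w, by simp, r0, r, t, u, ?_⟩,
      ⟨hg, h1, fun J _ => h2 J, h3⟩, fun J hJ => (Finset.mem_filter.1 hJ).2.2⟩
    rw [hid]
    congr 3
    symm
    apply Finset.sum_subset (Finset.subset_univ _)
    intro J _ hJ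
    rw [h4 J (by simpa using hJ), sosOf_nil, zero_mul]

theorem PScone_add {f g : MvPoly n} (hf : f ∈ PScone n ℓ m q p c w D)
    (hg : g ∈ PScone n ℓ m q p c w D) : f + g ∈ PScone n ℓ m q p c w D := by
  rw [mem_PScone_iff] at *
  obtain ⟨hf, r0, r, t, u, hid, h1, h2, h3, h4⟩ := hf
  obtain ⟨hg, r0', r', t', u', hid', h1', h2', h3', h4'⟩ := hg
  refine ⟨(totalDegree_add f g).trans (max_le hf hg), r0 ++ r0', fun J => r J ++ r' J,
    fun j => t j + t' j, fun a => u a + u' a, ?_, ?_, ?_, ?_, ?_⟩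
  · simp only [sosOf_append, add_mul, Finset.sum_add_distrib]
    rw [hid, hid']
    ring
  · rw [sosOf_append]
    exact (totalDegree_add _ _).trans (max_le h1 h1')
  · intro J
    simp only [sosOf_append]
    exact deg_add_aux (h2 J) (h2' J)
  · intro j
    exact deg_add_aux (h3 j) (h3' j)
  · intro J hJ
    simp [h4 J hJ, h4' J hJ]

theorem PScone_smul {f : MvPoly n} (hf : f ∈ PScone n ℓ m q p c w D) (a : ℝ) (ha : 0 ≤ a) :
    C a * f ∈ PScone n ℓ m q p c w D := by
  rw [mem_PScone_iff] at *
  obtain ⟨hf, r0, r, t, u, hid, h1, h2, h3, h4⟩ := hf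
  refine ⟨(totalDegree_C_mul_le a f).trans hf, r0.map (C (Real.sqrt a) * ·),
    fun J => (r J).map (C (Real.sqrt a) * ·),
    fun j => C a * t j, fun b => C a * u b, ?_, ?_, ?_, ?_, ?_⟩
  · simp only [sosOf_scale a ha, mul_assoc, ← Finset.mul_sum]
    rw [hid]
    ring
  · rw [sosOf_scale a ha]
    exact (totalDegree_C_mul_le _ _).trans h1
  · intro J h
    simp only [sosOf_scale a ha] at h ⊢
    have := h2 J (right_ne_zero_of_mul h)
    have := totalDegree_C_mul_le a (sosOf (r J))
    omega
  · intro j h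
    have := h3 j (right_ne_zero_of_mul h)
    have := totalDegree_C_mul_le a (t j)
    show (C a * t j).totalDegree + _ ≤ D
    omega
  · intro J hJ
    simp [h4 J hJ]

/-- A polynomial congruent, modulo the Boolean ideal, to a low-degree sum of squares. -/
theorem PScone_of_sos {f : MvPoly n} (hf : f.totalDegree ≤ D) (l : List (MvPoly n))
    (hl : (sosOf l).totalDegree ≤ D)
    (h : f - sosOf l ∈ Ideal.span (Set.range (boolAxiom n))) :
    f ∈ PScone n ℓ m q p c w D := by
  rw [Ideal.mem_span_range_iff_exists_fun] at h
  obtain ⟨u, hu⟩ := h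
  rw [mem_PScone_iff]
  refine ⟨hf, l, fun _ => [], fun _ => 0, u, ?_, hl, ?_, ?_, ?_⟩
  · rw [hu]; simp [sosOf_nil]
  · simp [sosOf_nil]
  · simp
  · simp

theorem monomial_idem (s : Fin n ⊕ Fin n →₀ ℕ) :
    (monomial s (1 : ℝ)) ^ 2 - monomial s 1 ∈ Ideal.span (Set.range (boolAxiom n)) := by
  rw [← Ideal.Quotient.eq, map_pow, pow_two]
  change IsIdempotentElem _
  rw [monomial_eq, map_mul, map_one, map_one, one_mul, Finsupp.prod, map_prod]
  apply Finset.prod_induction _ IsIdempotentElem (fun a b ha hb => ha.mul hb)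
    IsIdempotentElem.one
  intro i _
  rw [map_pow]
  apply IsIdempotentElem.pow
  rw [IsIdempotentElem, ← pow_two, ← map_pow, Ideal.Quotient.eq]
  apply Ideal.subset_span
  rcases i with i | i
  · exact ⟨(0, i), by simp [boolAxiom]⟩
  · exact ⟨(1, i), by simp [boolAxiom]⟩

theorem PScone_monomial (d : ℕ) (s : Fin n ⊕ Fin n →₀ ℕ) (hs : s.degree ≤ 2 * d)
    (ε : ℝ) (hε : ε ^ 2 = 1) :
    1 + C ε * monomial s 1 ∈ PScone n ℓ m q p c w (2 * d) := by
  obtain ⟨s1, s2, rfl, h1, h2⟩ : ∃ s1 s2 : Fin n ⊕ Fin n →₀ ℕ, s = s1 + s2 ∧ s1.degree ≤ d ∧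
      s2.degree ≤ d := by
    obtain ⟨g, hg, hgd⟩ := Finsupp.exists_le_degree_eq s (min d s.degree) (min_le_right _ _)
    obtain ⟨f, rfl⟩ := le_iff_exists_add.mp hg
    refine ⟨g, f, rfl, by omega, ?_⟩
    rw [map_add] at hs hgd
    omega
  set a : MvPoly n := monomial s1 1 with ha
  set b : MvPoly n := monomial s2 1 with hb
  have hab : (monomial (s1 + s2) (1 : ℝ) : MvPoly n) = a * b := by
    rw [ha, hb, monomial_mul, one_mul]
  have hda : a.totalDegree ≤ d := (totalDegree_monomial_le _ _).trans h1
  have hdb : b.totalDegree ≤ d := (totalDegree_monomial_le _ _).trans h2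
  have hsq : ∀ f : MvPoly n, f.totalDegree ≤ d → (f ^ 2).totalDegree ≤ 2 * d := fun f hf =>
    (totalDegree_pow f 2).trans (Nat.mul_le_mul_left 2 hf)
  have hadd : ∀ (k : ℕ) (f g : MvPoly n), f.totalDegree ≤ k → g.totalDegree ≤ k →
      (f + g).totalDegree ≤ k := fun k f g hf hg => (totalDegree_add f g).trans (max_le hf hg)
  have hsub : ∀ (k : ℕ) (f g : MvPoly n), f.totalDegree ≤ k → g.totalDegree ≤ k →
      (f - g).totalDegree ≤ k := fun k f g hf hg => (totalDegree_sub f g).trans (max_le hf hg)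
  have h1d : ∀ k, (1 : MvPoly n).totalDegree ≤ k := fun k => by simp
  have key : C (2 : ℝ) * (1 + C ε * (a * b)) ∈ PScone n ℓ m q p c w (2 * d) := by
    apply PScone_of_sos _ [a + C ε * b, 1 - a, 1 - b]
    · simp only [sosOf, List.map_cons, List.map_nil, List.sum_cons, List.sum_nil, add_zero]
      exact hadd _ _ _ (hsq _ (hadd _ _ _ hda ((totalDegree_C_mul_le _ _).trans hdb)))
        (hadd _ _ _ (hsq _ (hsub _ _ _ (h1d _) hda)) (hsq _ (hsub _ _ _ (h1d _) hdb)))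
    · have : C (2 : ℝ) * (1 + C ε * (a * b)) - sosOf [a + C ε * b, 1 - a, 1 - b]
          = (-2) * (a ^ 2 - a) + (-2) * (b ^ 2 - b) := by
        have hC2 : (C (2 : ℝ) : MvPoly n) = 2 := map_ofNat C 2
        have hCε : (C ε : MvPoly n) ^ 2 = 1 := by rw [← C_pow, hε, C_1]
        simp only [sosOf, List.map_cons, List.map_nil, List.sum_cons, List.sum_nil, add_zero, hC2]
        linear_combination (-b ^ 2) * hCε
      rw [this]
      exact Ideal.add_mem _ (Ideal.mul_mem_left _ _ (monomial_idem s1))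
        (Ideal.mul_mem_left _ _ (monomial_idem s2))
    · refine (totalDegree_C_mul_le _ _).trans (hadd _ _ _ (h1d _) ?_)
      refine (totalDegree_C_mul_le _ _).trans ((totalDegree_mul _ _).trans ?_)
      omega
  have := PScone_smul key (1 / 2) (by norm_num)
  rw [← mul_assoc, ← C_mul] at this
  rw [hab]
  simpa using this

theorem one_mem_PScone : (1 : MvPoly n) ∈ PScone n ℓ m q p c w D :=
  PScone_of_sos (by simp) [1] (by simp [sosOf]) (by simp [sosOf])

theorem zero_mem_PScone : (0 : MvPoly n) ∈ PScone n ℓ m q p c w D := by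
  simpa using PScone_smul (one_mem_PScone (q := q) (p := p) (c := c) (w := w) (D := D)) 0 le_rfl

theorem PScone_unit (d : ℕ) (f : MvPoly n) (hf : f.totalDegree ≤ 2 * d) :
    ∃ r : ℝ, C r + f ∈ PScone n ℓ m q p c w (2 * d) := by
  have key : ∀ T : Finset (Fin n ⊕ Fin n →₀ ℕ), T ⊆ f.support →
      ∃ r : ℝ, C r + ∑ s ∈ T, monomial s (f.coeff s) ∈ PScone n ℓ m q p c w (2 * d) := by
    classical
    intro T
    induction T using Finset.induction_on with
    | empty => exact fun _ => ⟨0, by simpa using zero_mem_PScone⟩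
    | insert s T hs ih =>
      intro hT
      obtain ⟨r, hr⟩ := ih ((Finset.subset_insert _ _).trans hT)
      have hsd : s.degree ≤ 2 * d :=
        (le_totalDegree (hT (Finset.mem_insert_self s T))).trans hf
      obtain ⟨ε, hε, hεa⟩ : ∃ ε : ℝ, ε ^ 2 = 1 ∧ |f.coeff s| * ε = f.coeff s := by
        rcases le_total 0 (f.coeff s) with h | h
        · exact ⟨1, by norm_num, by rw [abs_of_nonneg h]; ring⟩
        · exact ⟨-1, by norm_num, by rw [abs_of_nonpos h]; ring⟩
      have h1 := PScone_smul (PScone_monomial (q := q) (p := p) (c := c) (w := w) d s hsd ε hε)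
        |f.coeff s| (abs_nonneg _)
      refine ⟨r + |f.coeff s|, ?_⟩
      convert PScone_add h1 hr using 1
      have h2 : (monomial s (f.coeff s) : MvPoly n)
          = C |f.coeff s| * (C ε * monomial s 1) := by
        rw [C_mul_monomial, C_mul_monomial, mul_one, hεa]
      rw [Finset.sum_insert hs, h2, C_add]
      ring
  obtain ⟨r, hr⟩ := key f.support subset_rfl
  exact ⟨r, by rwa [support_sum_monomial_coeff] at hr⟩

end helpers

/-- **Theorem 2 (zero-gap duality for PS with cut-off functions).**
`sup{r : Q ⊢^c_{w,2d} p ≥ r} = inf{E(p) : E ∈ ℰ^c_{w,2d}(Q)}` in `ℝ ∪ {±∞}`, and if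
`ℰ^c_{w,2d}(Q)` is nonempty the infimum is attained. -/
theorem statement2 (d : ℕ) (hd : 0 < d) (n ℓ m : ℕ) (q : Fin ℓ → MvPoly n)
    (p : Fin m → MvPoly n) (c : Finset (Fin ℓ) ⊕ Fin m → ℕ) (hc : IsCutoff q p c)
    (w : ℕ) (hw : 0 < w)
    (P : restrictTotalDegree (Fin n ⊕ Fin n) ℝ (2 * d)) :
    sSup ((fun r : ℝ => (r : EReal)) ''
        {r : ℝ | (P : MvPoly n) - C r ∈ PScone n ℓ m q p c w (2 * d)})
      = sInf ((fun E : restrictTotalDegree (Fin n ⊕ Fin n) ℝ (2 * d) →ₗ[ℝ] ℝ =>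
          ((E P : ℝ) : EReal)) '' PseudoExp n ℓ m q p c w (2 * d)) ∧
    ((PseudoExp n ℓ m q p c w (2 * d)).Nonempty →
      ∃ E ∈ PseudoExp n ℓ m q p c w (2 * d),
        ∀ E' ∈ PseudoExp n ℓ m q p c w (2 * d), E P ≤ E' P) := by
  classical
  let V := restrictTotalDegree (Fin n ⊕ Fin n) ℝ (2 * d)
  let K : PointedCone ℝ V :=
    { carrier := {x | (x : MvPoly n) ∈ PScone n ℓ m q p c w (2 * d)}
      zero_mem' := zero_mem_PScone
      add_mem' := fun {x y} hx hy => PScone_add hx hy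
      smul_mem' := by
        rintro ⟨a, ha⟩ x hx
        show ((a • x : V) : MvPoly n) ∈ PScone n ℓ m q p c w (2 * d)
        rw [Submodule.coe_smul, smul_eq_C_mul]
        exact PScone_smul hx a ha }
  have hK : ∀ x : V, x ∈ K ↔ (x : MvPoly n) ∈ PScone n ℓ m q p c w (2 * d) := fun _ => Iff.rfl
  let e : V := ⟨1, by rw [mem_restrictTotalDegree]; simp⟩
  have hre : ∀ r : ℝ, ((r • e : V) : MvPoly n) = C r := fun r => by
    rw [Submodule.coe_smul, smul_eq_C_mul]
    exact mul_one _
  have he : e ∈ K := one_mem_PScone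
  have hu : ∀ x : V, ∃ r : ℝ, r • e + x ∈ K := fun x => by
    obtain ⟨r, hr⟩ := PScone_unit (q := q) (p := p) (c := c) (w := w) d x
      ((mem_restrictTotalDegree _ _ _).1 x.2)
    refine ⟨r, ?_⟩
    rw [hK, Submodule.coe_add, hre]
    exact hr
  have hSet : {r : ℝ | (P : MvPoly n) - C r ∈ PScone n ℓ m q p c w (2 * d)}
      = {r : ℝ | P - r • e ∈ K} := by
    ext r
    simp only [Set.mem_ofPred_eq]
    rw [hK, Submodule.coe_sub, hre]
  rw [hSet]
  by_cases hne : -e ∈ K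
  · have hemp : PseudoExp n ℓ m q p c w (2 * d) = ∅ := by
      rw [Set.eq_empty_iff_forall_notMem]
      rintro E ⟨h1, h2⟩
      have h3 := h1 e rfl
      have h4 := h2 _ hne
      rw [map_neg, h3] at h4
      linarith
    refine ⟨?_, fun h => absurd hemp h.ne_empty⟩
    rw [hemp, Set.image_empty, sInf_empty, EReal.eq_top_iff_forall_lt]
    intro y
    obtain ⟨r, hr⟩ := hu P
    have hm : P - (y + 1) • e ∈ K := by
      have hk := K.smul_mem (abs_nonneg (r + y + 1)) hne
      have hk2 := K.smul_mem (sub_nonneg.2 (le_abs_self (r + y + 1))) he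
      have h3 := K.add_mem (K.add_mem hr hk) hk2
      change r • e + P + |r + y + 1| • (-e) + (|r + y + 1| - (r + y + 1)) • e ∈ K at h3
      convert h3 using 1
      module
    refine lt_of_lt_of_le (EReal.coe_lt_coe_iff.2 (lt_add_one y)) (le_sSup ⟨y + 1, hm, rfl⟩)
  · obtain ⟨s, g, hlub, hge, hgK, hgP⟩ := abstract_duality K e he hu hne P
    have hgE : g ∈ PseudoExp n ℓ m q p c w (2 * d) := by
      refine ⟨fun x hx => ?_, fun x hx => hgK x hx⟩
      have : x = e := Subtype.ext hx
      rw [this, hge]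
    have hmin : ∀ E' ∈ PseudoExp n ℓ m q p c w (2 * d), g P ≤ E' P := by
      rintro E ⟨h1, h2⟩
      rw [hgP]
      refine hlub.2 fun r hr => ?_
      have := h2 _ hr
      rw [map_sub, map_smul, h1 e rfl] at this
      simp at this
      exact this
    refine ⟨?_, fun _ => ⟨g, hgE, hmin⟩⟩
    have hR : sInf ((fun E : restrictTotalDegree (Fin n ⊕ Fin n) ℝ (2 * d) →ₗ[ℝ] ℝ =>
          ((E P : ℝ) : EReal)) '' PseudoExp n ℓ m q p c w (2 * d)) = (s : EReal) := by
      apply le_antisymm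
      · rw [← hgP]; exact sInf_le ⟨g, hgE, rfl⟩
      · apply le_sInf
        rintro _ ⟨E, hE, rfl⟩
        rw [← hgP]
        exact EReal.coe_le_coe_iff.2 (hmin E hE)
    rw [hR]
    apply le_antisymm
    · apply sSup_le
      rintro _ ⟨r, hr, rfl⟩
      exact EReal.coe_le_coe_iff.2 (hlub.1 hr)
    · refine le_of_forall_lt fun y hy => ?_
      obtain ⟨z, hyz, hzs⟩ := EReal.lt_iff_exists_real_btwn.1 hy
      obtain ⟨r, hr, hzr⟩ := (lt_isLUB_iff hlub).1 (EReal.coe_lt_coe_iff.1 hzs)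
      exact hyz.trans (lt_of_lt_of_le (EReal.coe_lt_coe_iff.2 hzr) (le_sSup ⟨r, hr, rfl⟩))
end
end

section
/- Fix positive integers n, w, an indexed set Q of polynomials on n pairs of twin variables, and a cut-off function c for Q. Let i ∈ [n] and let d ≥ 2 be an integer. Then: (i) if Q[i/0] ⊢^c_{w,2d−2} −1 ≥ 0 and Q[i/1] ⊢^c_{w,2d} −1 ≥ 0, then Q ⊢^c_{w,2d} −1 ≥ 0; (ii) if Q[i/0] ⊢^c_{w,2d} −1 ≥ 0 and Q[i/1] ⊢^c_{w,2d−2} −1 ≥ 0, then Q ⊢^c_{w,2d} −1 ≥ 0. -/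
open MvPolynomial

noncomputable section

/-- The substitution `xᵢ := b`, `x̄ᵢ := 1 − b` (all other variables unchanged). -/
def substVar (n : ℕ) (i : Fin n) (b : ℝ) : MvPoly n →ₐ[ℝ] MvPoly n :=
  aeval fun v => match v with
    | Sum.inl j => if j = i then C b else X (Sum.inl j)
    | Sum.inr j => if j = i then C (1 - b) else X (Sum.inr j)

/-- The ideal generated by the Boolean axioms. -/
def boolIdeal (n : ℕ) : Ideal (MvPoly n) := Ideal.span (Set.range (boolAxiom n))

/-- The quotient map by the Boolean ideal. -/
def bq (n : ℕ) : MvPoly n →+* (MvPoly n ⧸ boolIdeal n) := Ideal.Quotient.mk (boolIdeal n)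

/-- Being a sum of squares. -/
def IsSOSPoly {n : ℕ} (f : MvPoly n) : Prop := ∃ l : List (MvPoly n), sosOf l = f

lemma isSOS_zero {n : ℕ} : IsSOSPoly (0 : MvPoly n) := ⟨[], by simp [sosOf]⟩

lemma isSOS_add {n : ℕ} {f g : MvPoly n} (hf : IsSOSPoly f) (hg : IsSOSPoly g) :
    IsSOSPoly (f + g) := by
  obtain ⟨l, rfl⟩ := hf
  obtain ⟨l', rfl⟩ := hg
  exact ⟨l ++ l', by simp [sosOf]⟩

lemma isSOS_sq {n : ℕ} (f : MvPoly n) : IsSOSPoly (f ^ 2) := ⟨[f], by simp [sosOf]⟩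

lemma isSOS_sq_mul {n : ℕ} (h : MvPoly n) {f : MvPoly n} (hf : IsSOSPoly f) :
    IsSOSPoly (h ^ 2 * f) := by
  obtain ⟨l, rfl⟩ := hf
  refine ⟨l.map (h * ·), ?_⟩
  induction l with
  | nil => simp [sosOf]
  | cons a l ih =>
    simp only [sosOf, List.map_cons, List.sum_cons] at ih ⊢
    rw [ih]; ring

/-- The cone, in a form convenient for manipulation: equality modulo the Boolean ideal. -/
def KCone {n ℓ m : ℕ} (q : Fin ℓ → MvPoly n) (p : Fin m → MvPoly n)
    (c : Finset (Fin ℓ) ⊕ Fin m → ℕ) (w D : ℕ) (g : MvPoly n) : Prop :=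
  ∃ (s0 : MvPoly n) (s : Finset (Fin ℓ) → MvPoly n) (t : Fin m → MvPoly n),
    IsSOSPoly s0 ∧ s0.totalDegree ≤ D ∧ (∀ J, IsSOSPoly (s J)) ∧
    (∀ J, s J ≠ 0 → J ≠ ∅ ∧ J.card ≤ w ∧ (s J).totalDegree + c (Sum.inl J) ≤ D) ∧
    (∀ j, t j ≠ 0 → (t j).totalDegree + c (Sum.inr j) ≤ D) ∧
    bq n g = bq n (s0 + ∑ J, s J * ∏ j ∈ J, q j + ∑ j, t j * p j)

section cone
variable {n ℓ m : ℕ} {q : Fin ℓ → MvPoly n} {p : Fin m → MvPoly n}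
    {c : Finset (Fin ℓ) ⊕ Fin m → ℕ} {w D : ℕ}

lemma bq_eq_iff (f g : MvPoly n) :
    bq n f = bq n g ↔ ∃ u : Fin 3 × Fin n → MvPoly n, f = g + ∑ a, u a * boolAxiom n a := by
  rw [bq, Ideal.Quotient.eq, boolIdeal, Ideal.mem_span_range_iff_exists_fun]
  constructor
  · rintro ⟨u, hu⟩
    exact ⟨u, by rw [hu]; ring⟩
  · rintro ⟨u, hu⟩
    exact ⟨u, by rw [hu]; ring⟩

lemma kcone_of_pscone {g : MvPoly n} (h : g ∈ PScone n ℓ m q p c w D) :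
    KCone q p c w D g := by
  classical
  obtain ⟨-, π, ⟨-, h0, h1, h2⟩, hw⟩ := h
  refine ⟨sosOf π.r0, fun J => if J ∈ π.Js then sosOf (π.r J) else 0, π.t, ⟨_, rfl⟩, h0, ?_, ?_,
    h2, ?_⟩
  · intro J
    dsimp only
    split_ifs
    · exact ⟨_, rfl⟩
    · exact isSOS_zero
  · intro J hJ
    dsimp only at hJ ⊢
    split_ifs at hJ ⊢ with hm
    · exact ⟨fun h => π.empty_not_mem (h ▸ hm), hw J hm, h1 J hm hJ⟩
    · exact absurd rfl hJ
  · rw [bq_eq_iff]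
    refine ⟨π.u, ?_⟩
    have := π.identity
    simpa [ite_mul, Finset.sum_ite_mem] using this

lemma pscone_of_kcone {g : MvPoly n} (hg : g.totalDegree ≤ D) (h : KCone q p c w D g) :
    g ∈ PScone n ℓ m q p c w D := by
  classical
  obtain ⟨s0, s, t, ⟨l0, rfl⟩, h0, hs, h1, h2, he⟩ := h
  choose l hl using hs
  obtain ⟨u, hu⟩ := (bq_eq_iff _ _).1 he
  have hsum : ∑ J ∈ Finset.univ.filter (fun J => s J ≠ 0), sosOf (l J) * ∏ j ∈ J, q j
      = ∑ J, s J * ∏ j ∈ J, q j := by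
    rw [Finset.sum_filter]
    refine Finset.sum_congr rfl fun J _ => ?_
    by_cases hJ : s J = 0
    · simp [hJ]
    · simp [hJ, hl]
  refine ⟨hg, ⟨Finset.univ.filter (fun J => s J ≠ 0), ?_, l0, l, t, u, ?_⟩, ⟨hg, h0, ?_, h2⟩, ?_⟩
  · intro h
    exact (h1 ∅ (Finset.mem_filter.1 h).2).1 rfl
  · rw [hsum]; exact hu
  · intro J hJ _
    dsimp only
    rw [hl]
    exact (h1 J (Finset.mem_filter.1 hJ).2).2.2
  · intro J hJ
    exact (h1 J (Finset.mem_filter.1 hJ).2).2.1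

lemma kcone_congr {f g : MvPoly n} (hfg : bq n f = bq n g) (h : KCone q p c w D f) :
    KCone q p c w D g := by
  obtain ⟨s0, s, t, a1, a2, a3, a4, a5, a6⟩ := h
  exact ⟨s0, s, t, a1, a2, a3, a4, a5, hfg ▸ a6⟩

lemma kcone_sos {f : MvPoly n} (hf : IsSOSPoly f) (hd : f.totalDegree ≤ D) :
    KCone q p c w D f :=
  ⟨f, 0, 0, hf, hd, fun _ => isSOS_zero, fun _ h => absurd rfl h, fun _ h => absurd rfl h,
    by simp⟩

lemma kcone_sq {f : MvPoly n} {k : ℕ} (hd : f.totalDegree ≤ k) (hk : 2 * k ≤ D) :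
    KCone q p c w D (f ^ 2) := by
  refine kcone_sos (isSOS_sq f) ?_
  have := totalDegree_pow f 2
  omega

lemma kcone_add {f g : MvPoly n} (hf : KCone q p c w D f) (hg : KCone q p c w D g) :
    KCone q p c w D (f + g) := by
  obtain ⟨s0, s, t, a1, a2, a3, a4, a5, a6⟩ := hf
  obtain ⟨s0', s', t', b1, b2, b3, b4, b5, b6⟩ := hg
  refine ⟨s0 + s0', s + s', t + t', isSOS_add a1 b1,
    (totalDegree_add _ _).trans (max_le a2 b2), fun J => isSOS_add (a3 J) (b3 J), ?_, ?_, ?_⟩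
  · intro J hJ
    rw [Pi.add_apply] at hJ ⊢
    by_cases h1 : s J = 0
    · rw [h1, zero_add] at hJ ⊢
      exact b4 J hJ
    by_cases h2 : s' J = 0
    · rw [h2, add_zero]
      exact a4 J h1
    obtain ⟨e1, e2, e3⟩ := a4 J h1
    obtain ⟨-, -, e4⟩ := b4 J h2
    refine ⟨e1, e2, ?_⟩
    have := totalDegree_add (s J) (s' J)
    omega
  · intro J hJ
    rw [Pi.add_apply] at hJ ⊢
    by_cases h1 : t J = 0
    · rw [h1, zero_add] at hJ ⊢
      exact b5 J hJ
    by_cases h2 : t' J = 0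
    · rw [h2, add_zero]
      exact a5 J h1
    have e3 := a5 J h1
    have e4 := b5 J h2
    have := totalDegree_add (t J) (t' J)
    omega
  · rw [map_add, a6, b6, ← map_add]
    congr 1
    simp only [Pi.add_apply, add_mul, Finset.sum_add_distrib]
    ring

/-- Multiplication by a square (with a weaker congruence `σ` on the axioms). -/
lemma kcone_sq_mul (σ : MvPoly n →ₐ[ℝ] MvPoly n) (y : MvPoly n) (k : ℕ)
    (hy : y.totalDegree ≤ k) {D' : ℕ} (hD : D' + 2 * k ≤ D)
    (hσ : ∀ f, bq n y * bq n (σ f) = bq n y * bq n f) {g : MvPoly n}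
    (hg : KCone (fun j => σ (q j)) (fun j => σ (p j)) c w D' g) :
    KCone q p c w D (y ^ 2 * g) := by
  obtain ⟨s0, s, t, a1, a2, a3, a4, a5, a6⟩ := hg
  have hdeg : ∀ f : MvPoly n, (y ^ 2 * f).totalDegree ≤ f.totalDegree + 2 * k := by
    intro f
    have h1 := totalDegree_mul (y ^ 2) f
    have h2 := totalDegree_pow y 2
    omega
  refine ⟨y ^ 2 * s0, fun J => y ^ 2 * s J, fun j => y ^ 2 * t j, isSOS_sq_mul _ a1, ?_,
    fun J => isSOS_sq_mul _ (a3 J), ?_, ?_, ?_⟩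
  · have := hdeg s0
    omega
  · intro J hJ
    obtain ⟨e1, e2, e3⟩ := a4 J (right_ne_zero_of_mul hJ)
    refine ⟨e1, e2, ?_⟩
    have := hdeg (s J)
    dsimp only
    omega
  · intro j hj
    have e3 := a5 j (right_ne_zero_of_mul hj)
    have := hdeg (t j)
    dsimp only
    omega
  · have key : ∀ a f : MvPoly n, bq n (y ^ 2) * bq n (a * σ f) = bq n (y ^ 2 * a * f) := by
      intro a f
      have := hσ f
      simp only [map_mul, map_pow]
      linear_combination bq n y * bq n a * this
    rw [map_mul, a6, ← map_mul]
    simp only [mul_add, Finset.mul_sum, map_add, map_sum]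
    have e1 : ∀ J : Finset (Fin ℓ), bq n (y ^ 2 * (s J * ∏ j ∈ J, σ (q j)))
        = bq n (y ^ 2 * s J * ∏ j ∈ J, q j) := fun J => by
      rw [map_mul (bq n) (y ^ 2), ← map_prod, key]
    have e2 : ∀ j, bq n (y ^ 2 * (t j * σ (p j))) = bq n (y ^ 2 * t j * p j) := fun j => by
      rw [map_mul (bq n) (y ^ 2), key]
    rw [Finset.sum_congr rfl fun J _ => e1 J, Finset.sum_congr rfl fun j _ => e2 j]

lemma kcone_smul {a : ℝ} (ha : 0 ≤ a) {g : MvPoly n} (hg : KCone q p c w D g) :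
    KCone q p c w D (C a * g) := by
  have := kcone_sq_mul (q := q) (p := p) (c := c) (w := w) (D := D) (D' := D)
    (AlgHom.id ℝ _) (C (Real.sqrt a)) 0 (by simp) (by omega) (fun _ => rfl) hg
  rwa [← C_pow, Real.sq_sqrt ha] at this

lemma bq_X_sq (v : Fin n ⊕ Fin n) : bq n (X v) * bq n (X v) = bq n (X v) := by
  rw [← map_mul, bq, Ideal.Quotient.eq]
  rcases v with v | v
  · have : boolAxiom n (0, v) ∈ boolIdeal n := Ideal.subset_span ⟨_, rfl⟩
    simpa [boolAxiom, sq] using this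
  · have : boolAxiom n (1, v) ∈ boolIdeal n := Ideal.subset_span ⟨_, rfl⟩
    simpa [boolAxiom, sq] using this

lemma bq_twin (i : Fin n) : bq n (X (Sum.inl i)) + bq n (X (Sum.inr i)) = 1 := by
  rw [← map_add, ← map_one (bq n), bq, Ideal.Quotient.eq]
  have : boolAxiom n (2, i) ∈ boolIdeal n := Ideal.subset_span ⟨_, rfl⟩
  simpa [boolAxiom] using this

/-- The product of a list of variables. -/
def lmon (l : List (Fin n ⊕ Fin n)) : MvPoly n := (l.map X).prod

lemma lmon_cons (v : Fin n ⊕ Fin n) (l : List (Fin n ⊕ Fin n)) :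
    lmon (v :: l) = X v * lmon l := by simp [lmon]

lemma lmon_append (l l' : List (Fin n ⊕ Fin n)) : lmon (l ++ l') = lmon l * lmon l' := by
  simp [lmon]

lemma lmon_deg (l : List (Fin n ⊕ Fin n)) : (lmon l).totalDegree ≤ l.length := by
  induction l with
  | nil => simp [lmon]
  | cons v l ih =>
    rw [lmon_cons]
    have h1 := totalDegree_mul (X v) (lmon l)
    have h2 : (X v : MvPoly n).totalDegree = 1 := totalDegree_X v
    simp only [List.length_cons]
    omega

lemma lmon_idem (l : List (Fin n ⊕ Fin n)) :
    bq n (lmon l) * bq n (lmon l) = bq n (lmon l) := by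
  induction l with
  | nil => simp [lmon]
  | cons v l ih =>
    rw [lmon_cons, map_mul]
    have := bq_X_sq v
    rw [mul_mul_mul_comm, this, ih]

lemma exists_lmon (s : (Fin n ⊕ Fin n) →₀ ℕ) :
    ∃ l : List (Fin n ⊕ Fin n), l.length = s.degree ∧ monomial s (1 : ℝ) = lmon l := by
  induction s using Finsupp.induction_linear with
  | zero => exact ⟨[], by simp, by simp [lmon]⟩
  | add f g hf hg =>
    obtain ⟨l, h1, h2⟩ := hf
    obtain ⟨l', h1', h2'⟩ := hg
    refine ⟨l ++ l', by simp [h1, h1'], ?_⟩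
    rw [lmon_append, ← h2, ← h2', monomial_mul, one_mul]
  | single v k =>
    refine ⟨List.replicate k v, by simp, ?_⟩
    simp [lmon, X_pow_eq_monomial]

/-- Linear decomposition of a polynomial into products of variables. -/
lemma poly_lmon_induction {P : MvPoly n → Prop} (N : ℕ) (h0 : P 0)
    (hadd : ∀ f g, P f → P g → P (f + g))
    (hmon : ∀ (a : ℝ) (l : List (Fin n ⊕ Fin n)), l.length ≤ N → P (C a * lmon l))
    (f : MvPoly n) (hf : f.totalDegree ≤ N) : P f := by
  classical
  rw [f.as_sum]
  refine Finset.sum_induction _ P hadd h0 ?_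
  intro s hs
  obtain ⟨l, h1, h2⟩ := exists_lmon s
  have h3 := le_totalDegree hs
  have : monomial s (coeff s f) = C (coeff s f) * lmon l := by
    rw [← h2, C_mul_monomial, mul_one]
  rw [this]
  refine hmon _ _ ?_
  rw [h1]
  exact le_trans h3 hf

/-- `f ≥ 0` up to arbitrarily small additive constants. -/
def ZCone (q : Fin ℓ → MvPoly n) (p : Fin m → MvPoly n)
    (c : Finset (Fin ℓ) ⊕ Fin m → ℕ) (w D : ℕ) (f : MvPoly n) : Prop :=
  ∀ ε : ℝ, 0 < ε → KCone q p c w D (f + C ε)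

lemma zcone_zero : ZCone q p c w D 0 := by
  intro ε hε
  have : KCone q p c w D ((C (Real.sqrt ε)) ^ 2) :=
    kcone_sq (k := 0) (by simp) (by omega)
  rwa [← C_pow, Real.sq_sqrt hε.le, ← zero_add (C ε)] at this

lemma zcone_add (f g : MvPoly n) (hf : ZCone q p c w D f) (hg : ZCone q p c w D g) :
    ZCone q p c w D (f + g) := by
  intro ε hε
  have := kcone_add (hf (ε / 2) (by linarith)) (hg (ε / 2) (by linarith))
  have e : f + C (ε / 2) + (g + C (ε / 2)) = f + g + C ε := by
    have : (C ε : MvPoly n) = C (ε / 2) + C (ε / 2) := by rw [← C_add]; congr 1; ring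
    rw [this]; ring
  rwa [e] at this

lemma zcone_congr {f g : MvPoly n} (hfg : bq n f = bq n g) (h : ZCone q p c w D f) :
    ZCone q p c w D g := fun ε hε =>
  kcone_congr (by rw [map_add, map_add, hfg]) (h ε hε)

lemma zcone_mon {d : ℕ} (hd : 1 ≤ d) (v : Fin n ⊕ Fin n)
    (hy : KCone q p c w (2 * d) (-X v)) (a : ℝ) (l : List (Fin n ⊕ Fin n))
    (hl : l.length ≤ 2 * d - 1) : ZCone q p c w (2 * d) (X v * (C a * lmon l)) := by
  intro ε hε
  obtain ⟨M1, M2, hM, hd1, hd2, hi1, hi2⟩ : ∃ M1 M2 : MvPoly n, lmon l = M1 * M2 ∧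
      M1.totalDegree ≤ d - 1 ∧ M2.totalDegree ≤ d ∧ bq n M1 * bq n M1 = bq n M1 ∧
      bq n M2 * bq n M2 = bq n M2 := by
    refine ⟨lmon (l.take (d - 1)), lmon (l.drop (d - 1)), ?_, ?_, ?_, lmon_idem _, lmon_idem _⟩
    · rw [← lmon_append, List.take_append_drop]
    · exact (lmon_deg _).trans (by simp)
    · refine (lmon_deg _).trans ?_
      rw [List.length_drop]
      omega
  obtain ⟨μ, hμ, hμε⟩ : ∃ μ : ℝ, 0 < μ ∧ μ ^ 2 = ε :=
    ⟨Real.sqrt ε, Real.sqrt_pos.2 hε, Real.sq_sqrt hε.le⟩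
  obtain ⟨r, hr⟩ : ∃ r : ℝ, 2 * r * μ = a := ⟨a / (2 * μ), by field_simp⟩
  have hX : (X v : MvPoly n).totalDegree = 1 := totalDegree_X v
  have hmulX : ∀ f : MvPoly n, f.totalDegree ≤ d - 1 → (X v * f).totalDegree ≤ d := by
    intro f hf
    have := totalDegree_mul (X v) f
    omega
  have hmulC : ∀ (b : ℝ) (f : MvPoly n), f.totalDegree ≤ d → (C b * f).totalDegree ≤ d := by
    intro b f hf
    have := totalDegree_mul (C b) f
    rw [totalDegree_C] at this
    omega
  have hone : ∀ (f : MvPoly n) (k : ℕ), f.totalDegree ≤ k → (1 - f).totalDegree ≤ k := by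
    intro f k hf
    have := totalDegree_sub 1 f
    rw [totalDegree_one] at this
    exact this.trans (by simpa using hf)
  have k1 : KCone q p c w (2 * d) ((C r * (X v * M1) + C μ * M2) ^ 2) :=
    kcone_sq (k := d) ((totalDegree_add _ _).trans
      (max_le (hmulC _ _ (hmulX _ hd1)) (hmulC _ _ hd2))) le_rfl
  have k2 : KCone q p c w (2 * d) ((C r * (X v * (1 - M1))) ^ 2) :=
    kcone_sq (k := d) (hmulC _ _ (hmulX _ (hone _ _ hd1))) le_rfl
  have k3 : KCone q p c w (2 * d) (C (r ^ 2) * (-X v)) := kcone_smul (sq_nonneg r) hy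
  have k4 : KCone q p c w (2 * d) ((C μ * (1 - M2)) ^ 2) :=
    kcone_sq (k := d) (hmulC _ _ (hone _ _ hd2)) le_rfl
  refine kcone_congr ?_ (kcone_add (kcone_add k1 k2) (kcone_add k3 k4))
  rw [hM, ← hμε, ← hr]
  have hv := bq_X_sq v
  simp only [map_add, map_mul, map_pow, map_sub, map_neg, map_one]
  have h2 : bq n (C 2) = 2 := by
    rw [show (C 2 : MvPoly n) = 2 from map_ofNat C 2, map_ofNat]
  rw [h2]
  generalize bq n (X v) = Y at *
  generalize bq n M1 = A at *
  generalize bq n M2 = B at *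
  generalize bq n (C r) = R at *
  generalize bq n (C μ) = U at *
  linear_combination (R ^ 2 * A ^ 2 + R ^ 2 * (1 - A) ^ 2) * hv + 2 * R ^ 2 * Y * hi1
    + 2 * U ^ 2 * hi2

lemma zcone_mul {d : ℕ} (hd : 1 ≤ d) (v : Fin n ⊕ Fin n)
    (hy : KCone q p c w (2 * d) (-X v)) (h : MvPoly n)
    (hh : h.totalDegree ≤ 2 * d - 1) : ZCone q p c w (2 * d) (X v * h) := by
  refine poly_lmon_induction (P := fun h => ZCone q p c w (2 * d) (X v * h)) (2 * d - 1) ?_ ?_ ?_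
    h hh
  · simpa using zcone_zero
  · intro f g hf hg
    rw [mul_add]
    exact zcone_add _ _ hf hg
  · intro a l hl
    exact zcone_mon hd v hy a l hl

end cone

/-- The substitution `σ` changes `f` by a multiple of `y` of controlled degree. -/
lemma subst_diff_lmon {n : ℕ} (σ : MvPoly n →ₐ[ℝ] MvPoly n) (y : MvPoly n)
    (h1 : ∀ v, ∃ e : ℝ, bq n (X v) - bq n (σ (X v)) = bq n (y * C e))
    (hdeg : ∀ v, (σ (X v)).totalDegree ≤ 1) (l : List (Fin n ⊕ Fin n)) :
    (σ (lmon l)).totalDegree ≤ l.length ∧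
    ∃ g : MvPoly n, (g = 0 ∨ g.totalDegree + 1 ≤ l.length) ∧
      bq n (lmon l) - bq n (σ (lmon l)) = bq n (y * g) := by
  induction l with
  | nil => exact ⟨by simp [lmon], 0, Or.inl rfl, by simp [lmon]⟩
  | cons v l ih =>
    obtain ⟨hd, g, hg, he⟩ := ih
    obtain ⟨e, hv⟩ := h1 v
    refine ⟨?_, X v * g + C e * σ (lmon l), Or.inr ?_, ?_⟩
    · rw [lmon_cons, map_mul]
      have h1 := totalDegree_mul (σ (X v)) (σ (lmon l))
      have h2 := hdeg v
      simp only [List.length_cons]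
      omega
    · simp only [List.length_cons, add_le_add_iff_right]
      refine (totalDegree_add _ _).trans (max_le ?_ ?_)
      · rcases hg with rfl | hg
        · simp
        · have h1 := totalDegree_mul (X v) g
          have h2 : (X v : MvPoly n).totalDegree = 1 := totalDegree_X v
          omega
      · have h1 := totalDegree_mul (C e) (σ (lmon l))
        rw [totalDegree_C] at h1
        omega
    · rw [lmon_cons]
      simp only [map_mul, map_add] at *
      linear_combination bq n (X v) * he + bq n (σ (lmon l)) * hv

lemma subst_diff {n : ℕ} (σ : MvPoly n →ₐ[ℝ] MvPoly n) (y : MvPoly n)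
    (h1 : ∀ v, ∃ e : ℝ, bq n (X v) - bq n (σ (X v)) = bq n (y * C e))
    (hdeg : ∀ v, (σ (X v)).totalDegree ≤ 1) (f : MvPoly n) :
    ∃ g : MvPoly n, (g = 0 ∨ g.totalDegree + 1 ≤ f.totalDegree) ∧
      bq n f - bq n (σ f) = bq n (y * g) := by
  generalize hN : f.totalDegree = N
  refine poly_lmon_induction (P := fun f => ∃ g : MvPoly n, (g = 0 ∨ g.totalDegree + 1 ≤ N) ∧
      bq n f - bq n (σ f) = bq n (y * g)) N ?_ ?_ ?_ f hN.le
  · exact ⟨0, Or.inl rfl, by simp⟩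
  · rintro f f' ⟨g, hg, he⟩ ⟨g', hg', he'⟩
    refine ⟨g + g', ?_, ?_⟩
    · rcases hg with rfl | hg
      · simpa using hg'
      rcases hg' with rfl | hg'
      · simpa using Or.inr hg
      have := totalDegree_add g g'
      right
      omega
    · simp only [map_mul, map_add] at *
      linear_combination he + he'
  · intro a l hl
    obtain ⟨-, g, hg, he⟩ := subst_diff_lmon σ y h1 hdeg l
    refine ⟨C a * g, ?_, ?_⟩
    · rcases hg with rfl | hg
      · simp
      have := totalDegree_mul (C a) g
      rw [totalDegree_C] at this
      right
      omega
    · have hC : σ (C a) = C a := σ.commutes a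
      simp only [map_mul, hC] at *
      linear_combination bq n (C a) * he

lemma subst_mul {n : ℕ} (σ : MvPoly n →ₐ[ℝ] MvPoly n) (y : MvPoly n)
    (h0 : ∀ v, bq n y * bq n (σ (X v)) = bq n y * bq n (X v)) (f : MvPoly n) :
    bq n y * bq n (σ f) = bq n y * bq n f := by
  induction f using MvPolynomial.induction_on with
  | C a => rw [show σ (C a) = C a from σ.commutes a]
  | add f g hf hg =>
    simp only [map_add]
    linear_combination hf + hg
  | mul_X f v hf =>
    simp only [map_mul]
    linear_combination bq n (σ (X v)) * hf + bq n f * h0 v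

lemma compose_core {n ℓ m w : ℕ} {q : Fin ℓ → MvPoly n} {p : Fin m → MvPoly n}
    {c : Finset (Fin ℓ) ⊕ Fin m → ℕ} (hc : IsCutoff q p c) {d : ℕ} (hd : 2 ≤ d)
    (σ τ : MvPoly n →ₐ[ℝ] MvPoly n) (v0 : Fin n ⊕ Fin n)
    (h0 : ∀ v, bq n (X v0) * bq n (σ (X v)) = bq n (X v0) * bq n (X v))
    (h1 : ∀ v, ∃ e : ℝ, bq n (X v) - bq n (τ (X v)) = bq n (X v0 * C e))
    (hdeg : ∀ v, (τ (X v)).totalDegree ≤ 1)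
    (H0 : (-1 : MvPoly n) ∈ PScone n ℓ m (fun j => σ (q j)) (fun j => σ (p j)) c w (2 * d - 2))
    (H1 : (-1 : MvPoly n) ∈ PScone n ℓ m (fun j => τ (q j)) (fun j => τ (p j)) c w (2 * d)) :
    (-1 : MvPoly n) ∈ PScone n ℓ m q p c w (2 * d) := by
  have hX : (X v0 : MvPoly n).totalDegree = 1 := totalDegree_X v0
  have hy : KCone q p c w (2 * d) (-X v0) := by
    have := kcone_sq_mul (D := 2 * d) σ (X v0) 1 hX.le (by omega) (subst_mul σ _ h0)
      (kcone_of_pscone H0)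
    refine kcone_congr ?_ this
    have := bq_X_sq v0
    simp only [map_mul, map_neg, map_pow, map_one]
    linear_combination -this
  have hZ : ∀ s F : MvPoly n, (s ≠ 0 → s.totalDegree + F.totalDegree ≤ 2 * d) →
      ZCone q p c w (2 * d) (s * (τ F - F)) := by
    intro s F hs
    by_cases hs0 : s = 0
    · simpa [hs0] using zcone_zero
    obtain ⟨g, hg, he⟩ := subst_diff τ _ h1 hdeg F
    have hz : ZCone q p c w (2 * d) (X v0 * (-(s * g))) := by
      refine zcone_mul (by omega) v0 hy _ ?_
      rw [totalDegree_neg]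
      rcases hg with rfl | hg
      · simp
      have h1 := totalDegree_mul s g
      have h2 := hs hs0
      omega
    refine zcone_congr ?_ hz
    simp only [map_mul, map_neg, map_sub] at *
    linear_combination bq n s * he
  obtain ⟨s0, s, t, a1, a2, a3, a4, a5, a6⟩ := kcone_of_pscone H1
  have hA : KCone q p c w (2 * d) (s0 + ∑ J, s J * ∏ j ∈ J, q j + ∑ j, t j * p j) :=
    ⟨s0, s, t, a1, a2, a3, a4, a5, rfl⟩
  have hz1 : ZCone q p c w (2 * d) (∑ J, s J * (τ (∏ j ∈ J, q j) - ∏ j ∈ J, q j)) := by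
    refine Finset.sum_induction _ (ZCone q p c w (2 * d)) zcone_add zcone_zero fun J _ => ?_
    refine hZ _ _ fun hJ => ?_
    have e1 := (a4 J hJ).2.2
    have e2 : (∏ j ∈ J, q j).totalDegree ≤ _ := totalDegree_finsetProd J q
    have e3 := hc.1 J
    omega
  have hz2 : ZCone q p c w (2 * d) (∑ j, t j * (τ (p j) - p j)) := by
    refine Finset.sum_induction _ (ZCone q p c w (2 * d)) zcone_add zcone_zero fun j _ => ?_
    refine hZ _ _ fun hj => ?_
    have e1 := a5 j hj
    have e3 := hc.2 j
    omega
  have hfin := kcone_smul (a := 2) (by norm_num)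
    (kcone_add hA (zcone_add _ _ hz1 hz2 (1 / 2) (by norm_num)))
  refine pscone_of_kcone (by rw [totalDegree_neg]; simp) (kcone_congr ?_ hfin)
  have h2 : (C 2 : MvPoly n) * C (1 / 2) = 1 := by rw [← C_mul]; norm_num
  have h2' : (C 2 : MvPoly n) = 2 := map_ofNat C 2
  have e : C 2 * (s0 + ∑ J, s J * ∏ j ∈ J, q j + ∑ j, t j * p j +
      (∑ J, s J * (τ (∏ j ∈ J, q j) - ∏ j ∈ J, q j) + ∑ j, t j * (τ (p j) - p j) + C (1 / 2)))
      = 2 * (s0 + ∑ J, s J * ∏ j ∈ J, τ (q j) + ∑ j, t j * τ (p j)) + 1 := by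
    simp only [mul_sub, Finset.sum_sub_distrib, map_prod]
    linear_combination h2 + (s0 + ∑ J, s J * ∏ j ∈ J, τ (q j) + ∑ j, t j * τ (p j)) * h2'
  rw [e, map_add, map_mul, ← a6, ← map_mul, ← map_add]
  congr 1
  ring

/-- **Lemma 7 (composing).** If `Q[i/0]` refutes in degree `2d−2` and `Q[i/1]` in
degree `2d` (both mod `c`, product-width `≤ w`), then `Q` refutes in degree `2d`;
and symmetrically. -/
theorem statement7 (n w : ℕ) (hn : 0 < n) (hw : 0 < w) (ℓ m : ℕ)
    (q : Fin ℓ → MvPoly n) (p : Fin m → MvPoly n)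
    (c : Finset (Fin ℓ) ⊕ Fin m → ℕ) (hc : IsCutoff q p c) (i : Fin n)
    (d : ℕ) (hd : 2 ≤ d) :
    (((-1 : MvPoly n) ∈ PScone n ℓ m (fun j => substVar n i 0 (q j))
        (fun j => substVar n i 0 (p j)) c w (2 * d - 2)) →
     ((-1 : MvPoly n) ∈ PScone n ℓ m (fun j => substVar n i 1 (q j))
        (fun j => substVar n i 1 (p j)) c w (2 * d)) →
      (-1 : MvPoly n) ∈ PScone n ℓ m q p c w (2 * d)) ∧
    (((-1 : MvPoly n) ∈ PScone n ℓ m (fun j => substVar n i 0 (q j))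
        (fun j => substVar n i 0 (p j)) c w (2 * d)) →
     ((-1 : MvPoly n) ∈ PScone n ℓ m (fun j => substVar n i 1 (q j))
        (fun j => substVar n i 1 (p j)) c w (2 * d - 2)) →
      (-1 : MvPoly n) ∈ PScone n ℓ m q p c w (2 * d)) := by
  have sl : ∀ (b : ℝ) (j : Fin n), substVar n i b (X (Sum.inl j)) =
      if j = i then C b else X (Sum.inl j) := fun b j => by simp [substVar]
  have sr : ∀ (b : ℝ) (j : Fin n), substVar n i b (X (Sum.inr j)) =
      if j = i then C (1 - b) else X (Sum.inr j) := fun b j => by simp [substVar]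
  have hdeg : ∀ (b : ℝ) v, (substVar n i b (X v)).totalDegree ≤ 1 := by
    intro b v
    rcases v with j | j
    · rw [sl]; split_ifs <;> simp
    · rw [sr]
      split_ifs
      · rw [totalDegree_C]; omega
      · rw [totalDegree_X]
  have ht := bq_twin i
  have hl := bq_X_sq (Sum.inl i : Fin n ⊕ Fin n)
  have hr := bq_X_sq (Sum.inr i : Fin n ⊕ Fin n)
  constructor
  · intro H0 H1
    refine compose_core hc hd (substVar n i 0) (substVar n i 1) (Sum.inr i) ?_ ?_ (hdeg 1) H0 H1
    · rintro (j | j)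
      · rw [sl]
        split_ifs with h
        · subst h
          simp only [map_zero]
          linear_combination hr - bq n (X (Sum.inr j)) * ht
        · rfl
      · rw [sr]
        split_ifs with h
        · subst h
          simp only [sub_zero, map_one]
          linear_combination -hr
        · rfl
    · rintro (j | j)
      · rw [sl]
        split_ifs with h
        · subst h
          refine ⟨-1, ?_⟩
          simp only [map_mul, map_neg, map_one]
          linear_combination ht
        · exact ⟨0, by simp⟩
      · rw [sr]
        split_ifs with h
        · subst h
          exact ⟨1, by simp⟩
        · exact ⟨0, by simp⟩
  · intro H0 H1
    refine compose_core hc hd (substVar n i 1) (substVar n i 0) (Sum.inl i) ?_ ?_ (hdeg 0) H1 H0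
    · rintro (j | j)
      · rw [sl]
        split_ifs with h
        · subst h
          simp only [map_one]
          linear_combination -hl
        · rfl
      · rw [sr]
        split_ifs with h
        · subst h
          simp only [sub_self, map_zero]
          linear_combination hl - bq n (X (Sum.inl j)) * ht
        · rfl
    · rintro (j | j)
      · rw [sl]
        split_ifs with h
        · subst h
          exact ⟨1, by simp⟩
        · exact ⟨0, by simp⟩
      · rw [sr]
        split_ifs with h
        · subst h
          refine ⟨-1, ?_⟩
          simp only [sub_zero, map_mul, map_neg, map_one]
          linear_combination ht
        · exact ⟨0, by simp⟩
end
end
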